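/- arXiv:2308.14109 — 3 statements merged into one kernel-verified Lean document; each statement's English description precedes it below -/
import Mathlib

section
/- Let (M,τ) be a tracial von Neumann algebra and let P, Q ≤ M be von Neumann subalgebras which are factors. If P and Q have unitarily conjugate corners, i.e. there exist nonzero projections p ∈ P, q ∈ Q and a partial isometry v ∈ M with v*v = p, vv* = q and v(pPp)v* = qQq, then P and Q are unitarily conjugate: there is a unitary u ∈ M with uPu* = Q. -/
/-! # Common framework: tracial von Neumann algebras in standard form,
amenability, free group factors, 1-bounded entropy, bimodules. -/

noncomputable section

open scoped InnerProductSpace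
open Filter

universe u

variable {H : Type u} [NormedAddCommGroup H] [InnerProductSpace ℂ H] [CompleteSpace H]

/-- A projection in `B(H)`. -/
def IsProj (p : H →L[ℂ] H) : Prop := p = p * p ∧ IsSelfAdjoint p

/-- `Ω` is a cyclic separating tracial unit vector for the von Neumann algebra `M`;
this realizes `(M, τ)` in standard form, with `τ a = ⟪a Ω, Ω⟫` and `L²(M) = H`. -/
structure IsTraceVector (M : VonNeumannAlgebra H) (Ω : H) : Prop where
  norm_one : ‖Ω‖ = 1
  tracial : ∀ a b : H →L[ℂ] H, a ∈ M → b ∈ M → ⟪(a * b) Ω, Ω⟫_ℂ = ⟪(b * a) Ω, Ω⟫_ℂ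
  cyclic : Dense ((fun a : H →L[ℂ] H => a Ω) '' (M : Set (H →L[ℂ] H)))
  separating : ∀ a : H →L[ℂ] H, a ∈ M → a Ω = 0 → a = 0

/-- The strong-operator-topology closure of a set of operators. -/
def sotClosure (s : Set (H →L[ℂ] H)) : Set (H →L[ℂ] H) :=
  {x | ∀ (F : Finset H) (ε : ℝ), 0 < ε → ∃ a ∈ s, ∀ v ∈ F, ‖x v - a v‖ < ε}

/-- Amenability (= hyperfiniteness) of a set of operators (e.g. the carrier of a von Neumann
subalgebra): there is a directed family of finite-dimensional *-subalgebras whose union is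
strongly dense. -/
def IsAmenableSet (s : Set (H →L[ℂ] H)) : Prop :=
  ∃ 𝒜 : Set (StarSubalgebra ℂ (H →L[ℂ] H)),
    (∀ A ∈ 𝒜, (A : Set (H →L[ℂ] H)) ⊆ s ∧ FiniteDimensional ℂ A) ∧
    DirectedOn (· ≤ ·) 𝒜 ∧
    s ⊆ sotClosure (⋃ A ∈ 𝒜, (A : Set (H →L[ℂ] H)))

/-- `P` is a maximal amenable von Neumann subalgebra of `M`. -/
def MaximalAmenable (M P : VonNeumannAlgebra H) : Prop :=
  P ≤ M ∧ IsAmenableSet (P : Set (H →L[ℂ] H)) ∧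
    ∀ Q : VonNeumannAlgebra H, Q ≤ M → IsAmenableSet (Q : Set (H →L[ℂ] H)) → P ≤ Q → Q = P

/-- Diffuseness: no nonzero minimal projections (every nonzero projection has a proper
nonzero subprojection). -/
def DiffuseSet (s : Set (H →L[ℂ] H)) : Prop :=
  ∀ p ∈ s, IsProj p → p ≠ 0 → ∃ q ∈ s, IsProj q ∧ q ≠ 0 ∧ q ≠ p ∧ q * p = q

/-- Triviality of the relative center: a factor. -/
def IsFactorSet (s : Set (H →L[ℂ] H)) : Prop :=
  ∀ z ∈ s, (∀ x ∈ s, z * x = x * z) → ∃ c : ℂ, z = c • (1 : H →L[ℂ] H)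

/-- A unitary element of `M`. -/
def unitaryIn (M : VonNeumannAlgebra H) (u : H →L[ℂ] H) : Prop :=
  u ∈ M ∧ star u * u = 1 ∧ u * star u = 1

/-- Order on projections. -/
def ProjLe (p q : H →L[ℂ] H) : Prop := p * q = p ∧ q * p = p

/-- The corner `e s e` of a set of operators. -/
def corner (e : H →L[ℂ] H) (s : Set (H →L[ℂ] H)) : Set (H →L[ℂ] H) :=
  (fun x => e * x * e) '' s

/-- The double commutant (the von Neumann algebra generated by a self-adjoint set). -/
def wstarGen (s : Set (H →L[ℂ] H)) : Set (H →L[ℂ] H) :=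
  Set.centralizer (Set.centralizer s)

/-! ## Interpolated free group factors -/

/-- The *-algebra generated by a single unitary `u` of a corner with unit `e`. -/
def genAlgAt (e u : H →L[ℂ] H) : Submodule ℂ (H →L[ℂ] H) :=
  Submodule.span ℂ ({e} ∪ {x | ∃ n : ℕ, 0 < n ∧ (x = u ^ n ∨ x = star u ^ n)})

/-- `u` is a Haar unitary in the corner `e M e`, with respect to the normalized trace
`τ(e)⁻¹ τ` of the corner (`τ a = ⟪a Ω, Ω⟫`). -/
def IsHaarUnitaryAt (Ω : H) (e u : H →L[ℂ] H) : Prop :=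
  star u * u = e ∧ u * star u = e ∧
    ∀ n : ℕ, 0 < n → ⟪(u ^ n) Ω, Ω⟫_ℂ = 0 ∧ ⟪(star u ^ n) Ω, Ω⟫_ℂ = 0

/-- Voiculescu free independence, w.r.t. the normalized trace of the corner with unit `e`,
of the family of *-algebras generated by the unitaries `u i`: alternating products of
trace-centred elements are centred. -/
def IsFreeFamilyAt (Ω : H) (e : H →L[ℂ] H) {ι : Type*} (u : ι → H →L[ℂ] H) : Prop :=
  ∀ (k : ℕ) (j : Fin (k + 1) → ι) (a : Fin (k + 1) → H →L[ℂ] H),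
    (∀ l : Fin k, j l.castSucc ≠ j l.succ) →
    (∀ l, a l ∈ genAlgAt e (u (j l)) ∧ ⟪a l Ω, Ω⟫_ℂ = 0) →
    ⟪(List.ofFn a).prod Ω, Ω⟫_ℂ = 0

/-- The corner `e M e` (with its normalized trace) is the free group factor `L(F_r)`:
it is generated by `r` free Haar unitaries. -/
def CornerIsFreeGroupFactor (M : VonNeumannAlgebra H) (Ω : H) (e : H →L[ℂ] H) (r : ℕ) : Prop :=
  ∃ u : Fin r → H →L[ℂ] H,
    (∀ i, u i ∈ M ∧ u i = e * u i * e ∧ IsHaarUnitaryAt Ω e (u i)) ∧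
    IsFreeFamilyAt Ω e u ∧
    corner e (M : Set (H →L[ℂ] H)) ⊆ wstarGen (insert e (⋃ i, {u i, star (u i)}))

/-- `(M, τ)` (in standard form with trace vector `Ω`) is the interpolated free group factor
`L(F_t)` of Dykema–Rădulescu: `M` is a factor and some corner of `M` of trace
`√((t-1)/(r-1))` is the free group factor `L(F_r)`, for an integer `r ≥ max (2, t)`. -/
def IsIFGF (t : ℝ) (M : VonNeumannAlgebra H) (Ω : H) : Prop :=
  IsTraceVector M Ω ∧ IsFactorSet (M : Set (H →L[ℂ] H)) ∧
    ∃ (r : ℕ) (e : H →L[ℂ] H), 2 ≤ r ∧ t ≤ (r : ℝ) ∧ e ∈ M ∧ IsProj e ∧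
      ⟪e Ω, Ω⟫_ℂ = ((Real.sqrt ((t - 1) / ((r : ℝ) - 1)) : ℝ) : ℂ) ∧
      CornerIsFreeGroupFactor M Ω e r

/-! ## 1-bounded entropy via microstates -/

/-- Operator norm of a complex matrix. -/
def matOpNorm {n : ℕ} (X : Matrix (Fin n) (Fin n) ℂ) : ℝ :=
  ‖(Matrix.toEuclideanCLM (𝕜 := ℂ) X : EuclideanSpace ℂ (Fin n) →L[ℂ] EuclideanSpace ℂ (Fin n))‖

/-- Normalized Hilbert-Schmidt distance between matrices. -/
def hsDist {n : ℕ} (X Y : Matrix (Fin n) (Fin n) ℂ) : ℝ :=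
  Real.sqrt ((Matrix.trace ((X - Y).conjTranspose * (X - Y))).re / n)

/-- The noncommutative law of a matrix tuple w.r.t. the normalized trace. -/
def matLaw {I : Type u} (n : ℕ) (X : I → Matrix (Fin n) (Fin n) ℂ) :
    FreeAlgebra ℂ I → ℂ :=
  fun q => Matrix.trace (FreeAlgebra.lift ℂ X q) / n

/-- Voiculescu microstate space: self-adjoint matrix tuples, norm bounded by `R`,
whose law lies in the neighborhood `O`. -/
def microstates {I : Type u} (R : I → ℝ) (O : Set (FreeAlgebra ℂ I → ℂ)) (n : ℕ) :
    Set (I → Matrix (Fin n) (Fin n) ℂ) :=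
  {X | (∀ i, IsSelfAdjoint (X i) ∧ matOpNorm (X i) ≤ R i) ∧ matLaw n X ∈ O}

/-- The orbital `(F, ε)`-neighborhood of a set of matrix tuples. -/
def orbitalNbhd {I : Type u} {n : ℕ} (F : Finset I) (ε : ℝ)
    (s : Set (I → Matrix (Fin n) (Fin n) ℂ)) : Set (I → Matrix (Fin n) (Fin n) ℂ) :=
  {Y | ∃ Y' ∈ s, ∃ U : Matrix (Fin n) (Fin n) ℂ, star U * U = 1 ∧ U * star U = 1 ∧
    ∀ i ∈ F, hsDist (Y i) (U * Y' i * star U) < ε}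

/-- Orbital covering numbers. -/
def orbCov {I : Type u} {n : ℕ} (F : Finset I) (ε : ℝ)
    (s : Set (I → Matrix (Fin n) (Fin n) ℂ)) : ℕ∞ :=
  ⨅ (s' : Set (I → Matrix (Fin n) (Fin n) ℂ)) (_ : s ⊆ orbitalNbhd F ε s'), s'.encard

/-- `log k / n²` as an extended real. -/
def logDivSq (k : ℕ∞) (n : ℕ) : EReal :=
  if k = 0 then ⊥ else if k = ⊤ then ⊤
  else ((Real.log k.toNat / (n : ℝ) ^ 2 : ℝ) : EReal)

/-- The 1-bounded entropy associated to a noncommutative law `lam` of an `(I ⊔ J)`-indexed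
tuple with operator norm cutoffs `R, S`: exponential growth rate of orbital covering numbers
of projections of microstate spaces onto the `I`-indexed coordinates. -/
def hEntLaw (I : Type u) (J : Type u) (R : I → ℝ) (S : J → ℝ)
    (lam : FreeAlgebra ℂ (I ⊕ J) → ℂ) : EReal :=
  ⨆ (F : Finset I) (ε : ℝ) (_ : 0 < ε),
    ⨅ (O : Set (FreeAlgebra ℂ (I ⊕ J) → ℂ)) (_ : O ∈ nhds lam),
      Filter.limsup
        (fun n : ℕ =>
          logDivSq (orbCov F ε ((fun X => X ∘ Sum.inl) '' microstates (Sum.elim R S) O n)) n)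
        Filter.atTop

/-- The self-adjoint elements of a set of operators (used as a canonical generating tuple). -/
def saElems (s : Set (H →L[ℂ] H)) : Type u := {a : H →L[ℂ] H // a ∈ s ∧ IsSelfAdjoint a}

/-- The noncommutative law of a tuple of operators w.r.t. the vector state of `Ω`. -/
def opLaw (Ω : H) {K : Type u} (z : K → H →L[ℂ] H) : FreeAlgebra ℂ K → ℂ :=
  fun q => ⟪(FreeAlgebra.lift ℂ z q) Ω, Ω⟫_ℂ

/-- The joint noncommutative law of the canonical generating tuples of the corners
`e P e ≤ e M e`, w.r.t. the normalized trace `τ(e)⁻¹ τ` of the corner. -/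
def cornerLaw (M : VonNeumannAlgebra H) (Ω : H) (e : H →L[ℂ] H) (P : Set (H →L[ℂ] H)) :
    FreeAlgebra ℂ (saElems (corner e P) ⊕ saElems (corner e (M : Set (H →L[ℂ] H)))) → ℂ :=
  fun q =>
    ⟪(e * FreeAlgebra.lift ℂ (Sum.elim (fun i => i.1) fun j => j.1) q * e) Ω, Ω⟫_ℂ / ⟪e Ω, Ω⟫_ℂ

/-- The 1-bounded entropy `h(ePe : eMe)` of the compression of `P` in the presence of the
compression of `M`, w.r.t. the normalized trace of the corner `e M e`. -/
def hCorner (M : VonNeumannAlgebra H) (Ω : H) (e : H →L[ℂ] H) (P : Set (H →L[ℂ] H)) : EReal :=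
  hEntLaw (saElems (corner e P)) (saElems (corner e (M : Set (H →L[ℂ] H))))
    (fun i => ‖i.1‖) (fun j => ‖j.1‖) (cornerLaw M Ω e P)

/-- The 1-bounded entropy `h(P : M)` of `P` in the presence of `M`. -/
def hSub (M : VonNeumannAlgebra H) (Ω : H) (P : Set (H →L[ℂ] H)) : EReal :=
  hCorner M Ω 1 P

/-- `P` is a Pinsker subalgebra of `M`: `h(P : M) ≤ 0`, and every strictly larger
subalgebra `Q ≤ M` has `h(Q : M) > 0`. -/
def IsPinsker (M : VonNeumannAlgebra H) (Ω : H) (P : VonNeumannAlgebra H) : Prop :=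
  P ≤ M ∧ hSub M Ω (P : Set (H →L[ℂ] H)) ≤ 0 ∧
    ∀ Q : VonNeumannAlgebra H, P ≤ Q → Q ≤ M → Q ≠ P →
      0 < hSub M Ω (Q : Set (H →L[ℂ] H))

/-- `p P p` is a Pinsker subalgebra of the compression `p M p` (von Neumann subalgebras of a
corner `pMp` are exactly the sets `p W p` with `W ≤ M` a von Neumann subalgebra
containing `p`). -/
def IsPinskerCorner (M : VonNeumannAlgebra H) (Ω : H) (p : H →L[ℂ] H)
    (P : Set (H →L[ℂ] H)) : Prop :=
  hCorner M Ω p P ≤ 0 ∧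
    ∀ W : VonNeumannAlgebra H, W ≤ M → p ∈ W →
      corner p P ⊆ corner p (W : Set (H →L[ℂ] H)) →
      corner p (W : Set (H →L[ℂ] H)) ≠ corner p P →
      0 < hCorner M Ω p (corner p (W : Set (H →L[ℂ] H)))

/-! ## `L²`-spaces, bimodules, the anti-coarse space -/

/-- The subspace `L²(N) ⊆ L²(M) = H`, for a subset `N ⊆ M`: the closure of `N Ω`. -/
def L2set (Ω : H) (s : Set (H →L[ℂ] H)) : Set H := closure ((fun a : H →L[ℂ] H => a Ω) '' s)

/-- `L²(N)` as a closed subspace of `H`. -/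
def L2sub (Ω : H) (s : Set (H →L[ℂ] H)) : Submodule ℂ H :=
  (Submodule.span ℂ ((fun a : H →L[ℂ] H => a Ω) '' s)).topologicalClosure

/-- `R` implements right multiplication by `b ∈ M` on `L²(M) = H`: it is the unique element of
the commutant `M'` with `R Ω = b Ω`. -/
def IsRightMul (M : VonNeumannAlgebra H) (Ω : H) (b R : H →L[ℂ] H) : Prop :=
  R ∈ Set.centralizer (M : Set (H →L[ℂ] H)) ∧ R Ω = b Ω

/-- A realization of the coarse `N`-`N` bimodule `L²(N) ⊗ L²(N)`: a Hilbert space with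
left/right `N`-actions and a map `(a, b) ↦ aΩ ⊗ bΩ` with total vectors, the correct inner
products, and the correct actions. Any such realization is canonically isomorphic to
`L²(N) ⊗ L²(N)`. -/
structure CoarseBimodule (M : VonNeumannAlgebra H) (Ω : H) (N : Set (H →L[ℂ] H)) :
    Type (u + 1) where
  K : Type u
  [nacg : NormedAddCommGroup K]
  [ips : InnerProductSpace ℂ K]
  [cs : CompleteSpace K]
  vec : (H →L[ℂ] H) → (H →L[ℂ] H) → K
  lact : (H →L[ℂ] H) → K →L[ℂ] K
  ract : (H →L[ℂ] H) → K →L[ℂ] K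
  inner_vec : ∀ a b c d : H →L[ℂ] H, a ∈ N → b ∈ N → c ∈ N → d ∈ N →
    ⟪vec a b, vec c d⟫_ℂ = ⟪a Ω, c Ω⟫_ℂ * ⟪b Ω, d Ω⟫_ℂ
  dense_span : Dense
    ((Submodule.span ℂ {x : K | ∃ a ∈ N, ∃ b ∈ N, x = vec a b} : Submodule ℂ K) : Set K)
  lact_vec : ∀ x a b : H →L[ℂ] H, x ∈ N → a ∈ N → b ∈ N → lact x (vec a b) = vec (x * a) b
  ract_vec : ∀ y a b : H →L[ℂ] H, y ∈ N → a ∈ N → b ∈ N → ract y (vec a b) = vec a (b * y)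

attribute [instance] CoarseBimodule.nacg CoarseBimodule.ips CoarseBimodule.cs

/-- The anti-coarse space `H_antic(N ≤ M)`: the joint kernel of all bounded `N`-`N` bimodular
maps `L²(M) → L²(N) ⊗ L²(N)`. -/
def antiCoarse (M : VonNeumannAlgebra H) (Ω : H) (N : Set (H →L[ℂ] H)) : Set H :=
  {ξ | ∀ (W : CoarseBimodule M Ω N) (T : H →L[ℂ] W.K),
    (∀ a ∈ N, ∀ η : H, T (a η) = W.lact a (T η)) →
    (∀ b ∈ N, ∀ R : H →L[ℂ] H, IsRightMul M Ω b R → ∀ η : H, T (R η) = W.ract b (T η)) →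
    T ξ = 0}

/-- For a set of vectors `Y ⊆ L²(M)`, the von Neumann algebra `W*(Y)` generated by the polar
parts and the spectral data of the unbounded operators `L_ξ`, `ξ ∈ Y`: equivalently, the
smallest von Neumann subalgebra `N ≤ M` with `Y ⊆ L²(N)`. -/
def WstarVec (M : VonNeumannAlgebra H) (Ω : H) (Y : Set H) : Set (H →L[ℂ] H) :=
  ⋂ (N : VonNeumannAlgebra H) (_ : N ≤ M) (_ : Y ⊆ L2set Ω (N : Set (H →L[ℂ] H))),
    (N : Set (H →L[ℂ] H))

/-! ## Generalized normalizers and intertwining spaces -/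

/-- The one-sided quasi-normalizer `q¹N_M(N)`. -/
def oneSidedQNormalizer (M : VonNeumannAlgebra H) (N : Set (H →L[ℂ] H)) :
    Set (H →L[ℂ] H) :=
  {x | x ∈ M ∧ ∃ (n : ℕ) (xs : Fin n → H →L[ℂ] H), (∀ j, xs j ∈ M) ∧
    ∀ a ∈ N, ∃ b : Fin n → H →L[ℂ] H, (∀ j, b j ∈ N) ∧ x * a = ∑ j, b j * xs j}

/-- The wq-normalizer `N^{wq}_M(N)`: unitaries `u ∈ M` with `uNu* ∩ N` diffuse. -/
def wqNormalizer (M : VonNeumannAlgebra H) (N : Set (H →L[ℂ] H)) : Set (H →L[ℂ] H) :=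
  {u | unitaryIn M u ∧ DiffuseSet ({x | ∃ a ∈ N, x = u * a * star u} ∩ N)}

/-- The set `s` contains a sequence of unitaries of `M` tending weakly to `0`. -/
def weakNullUnitaries (M : VonNeumannAlgebra H) (s : Set (H →L[ℂ] H)) : Prop :=
  ∃ w : ℕ → H →L[ℂ] H, (∀ n, unitaryIn M (w n) ∧ w n ∈ s) ∧
    ∀ ξ η : H, Filter.Tendsto (fun n => ⟪w n ξ, η⟫_ℂ) Filter.atTop (nhds 0)

/-- The very weak quasi-normalizer `N^{vwq}_M(N)`. -/
def vwqNormalizer (M : VonNeumannAlgebra H) (N : Set (H →L[ℂ] H)) : Set (H →L[ℂ] H) :=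
  {u | unitaryIn M u ∧ ∃ v, unitaryIn M v ∧
    weakNullUnitaries M ({x | ∃ a ∈ N, x = u * a * v} ∩ N)}

/-- The set `s ⊆ L²(M)` generates a right `P`-submodule of finite dimension (it is contained
in the closure of a finitely generated right `P`-module). -/
def finRankRight (M : VonNeumannAlgebra H) (Ω : H) (P : Set (H →L[ℂ] H)) (s : Set H) : Prop :=
  ∃ (n : ℕ) (ζ : Fin n → H),
    s ⊆ closure ((Submodule.span ℂ
      {η : H | ∃ j : Fin n, ∃ b ∈ P, ∃ R : H →L[ℂ] H, IsRightMul M Ω b R ∧ η = R (ζ j)} :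
        Submodule ℂ H) : Set H)

/-- `ξ` lies in the intertwining space `I_M(Q, P)`: the right `P`-module generated by `Q ξ P`
has finite dimension as a right `P`-module. -/
def intertwiners (M : VonNeumannAlgebra H) (Ω : H) (Q P : Set (H →L[ℂ] H)) (ξ : H) : Prop :=
  finRankRight M Ω P
    {η : H | ∃ a ∈ Q, ∃ b ∈ P, ∃ R : H →L[ℂ] H, IsRightMul M Ω b R ∧ η = a (R ξ)}

/-- The weak intertwining space `wI_{zMz}(Q, P)` computed inside the corner `z M z`:
the union of `I(Q₀, P)` over all diffuse von Neumann subalgebras `Q₀` of `Q` (with unit `z`).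
Taking `z = 1` gives the usual weak intertwining space `wI_M(Q, P)`. -/
def wIntertwinersAt (M : VonNeumannAlgebra H) (Ω : H) (z : H →L[ℂ] H)
    (Q P : Set (H →L[ℂ] H)) : Set H :=
  {ξ | ξ ∈ L2set Ω (corner z (M : Set (H →L[ℂ] H))) ∧
    ∃ W : VonNeumannAlgebra H, W ≤ M ∧ z ∈ W ∧
      corner z (W : Set (H →L[ℂ] H)) ⊆ Q ∧ DiffuseSet (corner z (W : Set (H →L[ℂ] H))) ∧
      intertwiners M Ω (corner z (W : Set (H →L[ℂ] H))) P ξ}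

/-- The weak intertwining space `wI_M(Q, P)`. -/
def wIntertwiners (M : VonNeumannAlgebra H) (Ω : H) (Q P : Set (H →L[ℂ] H)) : Set H :=
  wIntertwinersAt M Ω 1 Q P

/-- The relative commutant of a set `Q` inside (the carrier of) `Mw`. -/
def relComm (Mw : VonNeumannAlgebra H) (Q : Set (H →L[ℂ] H)) : Set (H →L[ℂ] H) :=
  {z | z ∈ Mw ∧ ∀ x ∈ Q, z * x = x * z}

/-! ## Tracial ultrapowers -/

/-- A realization of the tracial ultrapower `M^ω` of a tracial von Neumann algebra `(M, τ)`
in standard form: a tracial von Neumann algebra `(Mw, τ_ω)` in standard form, together with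
the quotient map `Φ` from bounded sequences in `M`, which is a surjective unital
*-homomorphism with `τ_ω(Φ(x)) = lim_ω τ(x_k)`. -/
structure Ultrapower (M : VonNeumannAlgebra H) (Ω : H) (ω : Ultrafilter ℕ) :
    Type (u + 1) where
  carrier : Type u
  [nacg : NormedAddCommGroup carrier]
  [ips : InnerProductSpace ℂ carrier]
  [cs : CompleteSpace carrier]
  Mw : VonNeumannAlgebra carrier
  vec : carrier
  traceVec : IsTraceVector Mw vec
  Φ : (ℕ → H →L[ℂ] H) → carrier →L[ℂ] carrier
  mem : ∀ x : ℕ → H →L[ℂ] H, (∀ k, x k ∈ M) → BddAbove (Set.range fun k => ‖x k‖) →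
    Φ x ∈ Mw
  surj : ∀ z ∈ Mw, ∃ x : ℕ → H →L[ℂ] H,
    (∀ k, x k ∈ M) ∧ BddAbove (Set.range fun k => ‖x k‖) ∧ Φ x = z
  map_add : ∀ x y : ℕ → H →L[ℂ] H, (∀ k, x k ∈ M) → BddAbove (Set.range fun k => ‖x k‖) →
    (∀ k, y k ∈ M) → BddAbove (Set.range fun k => ‖y k‖) → Φ (x + y) = Φ x + Φ y
  map_smul : ∀ (c : ℂ) (x : ℕ → H →L[ℂ] H), (∀ k, x k ∈ M) →
    BddAbove (Set.range fun k => ‖x k‖) → Φ (c • x) = c • Φ x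
  map_mul : ∀ x y : ℕ → H →L[ℂ] H, (∀ k, x k ∈ M) → BddAbove (Set.range fun k => ‖x k‖) →
    (∀ k, y k ∈ M) → BddAbove (Set.range fun k => ‖y k‖) → Φ (x * y) = Φ x * Φ y
  map_star : ∀ x : ℕ → H →L[ℂ] H, (∀ k, x k ∈ M) → BddAbove (Set.range fun k => ‖x k‖) →
    Φ (fun k => star (x k)) = star (Φ x)
  map_one : Φ 1 = 1
  norm_le : ∀ (x : ℕ → H →L[ℂ] H) (C : ℝ), (∀ k, x k ∈ M) → (∀ k, ‖x k‖ ≤ C) → ‖Φ x‖ ≤ C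
  trace_eq : ∀ x : ℕ → H →L[ℂ] H, (∀ k, x k ∈ M) → BddAbove (Set.range fun k => ‖x k‖) →
    Filter.Tendsto (fun k => ⟪x k Ω, Ω⟫_ℂ) (↑ω) (nhds ⟪Φ x vec, vec⟫_ℂ)

attribute [instance] Ultrapower.nacg Ultrapower.ips Ultrapower.cs

/-- The copy of `M` inside `M^ω` given by constant sequences. -/
def Ultrapower.diag {M : VonNeumannAlgebra H} {Ω : H} {ω : Ultrafilter ℕ}
    (U : Ultrapower M Ω ω) : Set (U.carrier →L[ℂ] U.carrier) :=
  {z | ∃ a ∈ M, z = U.Φ fun _ => a}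

/-- An ultrafilter on `ℕ` is free when it contains all cofinite sets. -/
def Ultrafilter.IsFreeUltrafilter (ω : Ultrafilter ℕ) : Prop :=
  (↑ω : Filter ℕ) ≤ Filter.cofinite


/-- The Hilbert space `H ⊗ ℓ²(n × n)` on which the matrix amplification `Mₙ(M)` acts in
standard form. -/
abbrev MatHilbert (n : ℕ) (H : Type u) [NormedAddCommGroup H] [InnerProductSpace ℂ H]
    [CompleteSpace H] : Type u :=
  PiLp 2 (fun _ : Fin n × Fin n => H)

/-- The action of a matrix of operators on `MatHilbert n H`, acting on the first
(column) index; the second index carries the right action. -/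
def matOp {n : ℕ} (T : Matrix (Fin n) (Fin n) (H →L[ℂ] H)) :
    MatHilbert n H →L[ℂ] MatHilbert n H :=
  ((PiLp.continuousLinearEquiv 2 ℂ (fun _ : Fin n × Fin n => H)).symm.toContinuousLinearMap.comp
    ((ContinuousLinearMap.pi fun ik : Fin n × Fin n =>
        ∑ j : Fin n, (T ik.1 j).comp (ContinuousLinearMap.proj (j, ik.2))).comp
      (PiLp.continuousLinearEquiv 2 ℂ (fun _ : Fin n × Fin n => H)).toContinuousLinearMap))

/-- The canonical trace vector for `Mₙ(M)` acting on `MatHilbert n H`. -/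
def matTraceVec (n : ℕ) (Ω : H) : MatHilbert n H :=
  (WithLp.equiv 2 (∀ _ : Fin n × Fin n, H)).symm
    (fun ik => if ik.1 = ik.2 then (Real.sqrt n)⁻¹ • Ω else 0)

/-- A realization of the tracial ultraproduct `∏_{k→ω} M_k(ℂ)` of matrix algebras with their
normalized traces: a tracial von Neumann algebra in standard form together with the quotient
map `Φ` from operator-norm-bounded sequences of matrices, a surjective unital *-homomorphism
with `τ(Φ(x)) = lim_ω tr_k(x_k)`. -/
structure MatrixUltraproduct (ω : Ultrafilter ℕ) : Type (u + 1) where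
  carrier : Type u
  [nacg : NormedAddCommGroup carrier]
  [ips : InnerProductSpace ℂ carrier]
  [cs : CompleteSpace carrier]
  Mw : VonNeumannAlgebra carrier
  vec : carrier
  traceVec : IsTraceVector Mw vec
  Φ : (∀ k : ℕ, Matrix (Fin k) (Fin k) ℂ) → carrier →L[ℂ] carrier
  mem : ∀ x : ∀ k : ℕ, Matrix (Fin k) (Fin k) ℂ,
    BddAbove (Set.range fun k => matOpNorm (x k)) → Φ x ∈ Mw
  surj : ∀ z ∈ Mw, ∃ x : ∀ k : ℕ, Matrix (Fin k) (Fin k) ℂ,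
    BddAbove (Set.range fun k => matOpNorm (x k)) ∧ Φ x = z
  map_add : ∀ x y : ∀ k : ℕ, Matrix (Fin k) (Fin k) ℂ,
    BddAbove (Set.range fun k => matOpNorm (x k)) →
    BddAbove (Set.range fun k => matOpNorm (y k)) →
    Φ (fun k => x k + y k) = Φ x + Φ y
  map_smul : ∀ (c : ℂ) (x : ∀ k : ℕ, Matrix (Fin k) (Fin k) ℂ),
    BddAbove (Set.range fun k => matOpNorm (x k)) → Φ (fun k => c • x k) = c • Φ x
  map_mul : ∀ x y : ∀ k : ℕ, Matrix (Fin k) (Fin k) ℂ,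
    BddAbove (Set.range fun k => matOpNorm (x k)) →
    BddAbove (Set.range fun k => matOpNorm (y k)) →
    Φ (fun k => x k * y k) = Φ x * Φ y
  map_star : ∀ x : ∀ k : ℕ, Matrix (Fin k) (Fin k) ℂ,
    BddAbove (Set.range fun k => matOpNorm (x k)) →
    Φ (fun k => star (x k)) = star (Φ x)
  map_one : Φ (fun _ => 1) = 1
  norm_le : ∀ (x : ∀ k : ℕ, Matrix (Fin k) (Fin k) ℂ) (C : ℝ),
    (∀ k, matOpNorm (x k) ≤ C) → ‖Φ x‖ ≤ C
  trace_eq : ∀ x : ∀ k : ℕ, Matrix (Fin k) (Fin k) ℂ,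
    BddAbove (Set.range fun k => matOpNorm (x k)) →
    Filter.Tendsto (fun k => Matrix.trace (x k) / (k : ℂ)) (↑ω) (nhds ⟪Φ x vec, vec⟫_ℂ)

attribute [instance] MatrixUltraproduct.nacg MatrixUltraproduct.ips MatrixUltraproduct.cs


section HelperLemmas

theorem vna_mem_of_comm (N : VonNeumannAlgebra H) (a : H →L[ℂ] H)
    (h : ∀ y ∈ N.commutant, y * a = a * y) : a ∈ N := by
  rw [← N.commutant_commutant]
  exact VonNeumannAlgebra.mem_commutant_iff.2 h

theorem vna_comm (N : VonNeumannAlgebra H) {a y : H →L[ℂ] H} (ha : a ∈ N)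
    (hy : y ∈ N.commutant) : a * y = y * a :=
  VonNeumannAlgebra.mem_commutant_iff.1 hy a ha

theorem norm_sq_of_star_mul (x : H →L[ℂ] H) (ξ : H) :
    ((‖x ξ‖ ^ 2 : ℝ) : ℂ) = ⟪(star x * x) ξ, ξ⟫_ℂ := by
  rw [ContinuousLinearMap.star_eq_adjoint, mul_apply_eq_comp,
    ContinuousLinearMap.adjoint_inner_left, inner_self_eq_norm_sq_to_K]
  norm_cast

theorem norm_eq_of_star_mul {x y : H →L[ℂ] H} (h : star x * x = star y * y) (ξ : H) :
    ‖x ξ‖ = ‖y ξ‖ := by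
  have h1 : ((‖x ξ‖ ^ 2 : ℝ) : ℂ) = ((‖y ξ‖ ^ 2 : ℝ) : ℂ) := by
    rw [norm_sq_of_star_mul, norm_sq_of_star_mul, h]
  have h2 := Complex.ofReal_injective h1
  exact (sq_eq_sq₀ (norm_nonneg _) (norm_nonneg _)).1 h2

theorem polar_in_vna (N : VonNeumannAlgebra H) (x : H →L[ℂ] H) (hx : x ∈ N) :
    ∃ a ∈ N, a * star a * a = a ∧ (x ≠ 0 → a ≠ 0) ∧ (∀ z, x * z = 0 → a * z = 0) ∧
      (∀ z, z * x = 0 → z * a = 0) := by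
  obtain ⟨h, hh, hsa, hN⟩ : ∃ h : H →L[ℂ] H, h * h = star x * x ∧ star h = h ∧
      ∀ y ∈ N.commutant, y * h = h * y := by
    refine ⟨CFC.abs x, CFC.abs_mul_abs x, (CFC.abs_nonneg x).isSelfAdjoint, fun y hy => ?_⟩
    have h1 : Commute x y := vna_comm N hx hy
    have h2 : Commute x (star y) := vna_comm N hx (star_mem hy)
    exact (h1.cfcAbs_left h2).symm
  have hn : ∀ ξ, ‖x ξ‖ = ‖h ξ‖ := fun ξ => norm_eq_of_star_mul (by rw [hsa, hh]) ξ
  set K : Submodule ℂ H := (LinearMap.range (h : H →ₗ[ℂ] H)).topologicalClosure with hK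
  have hKc : IsClosed (K : Set H) := Submodule.isClosed_topologicalClosure _
  have : CompleteSpace K := hKc.completeSpace_coe
  have hmem : ∀ ξ, h ξ ∈ K := fun ξ => Submodule.le_topologicalClosure _ ⟨ξ, rfl⟩
  have hKmin : ∀ T : H →L[ℂ] H, (∀ ξ, T (h ξ) = 0) → ∀ k ∈ K, T k = 0 := by
    intro T hT k hk
    have : K ≤ LinearMap.ker (T : H →ₗ[ℂ] H) := by
      apply Submodule.topologicalClosure_minimal
      · rintro _ ⟨ξ, rfl⟩
        exact hT ξ
      · exact T.isClosed_ker
    exact this hk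
  let e : H →ₗ[ℂ] K := LinearMap.codRestrict K (h : H →ₗ[ℂ] H) hmem
  have he : DenseRange e := by
    intro k
    rw [Metric.mem_closure_iff]
    intro ε hε
    have hk : (k : H) ∈ closure (LinearMap.range (h : H →ₗ[ℂ] H) : Set H) := k.2
    obtain ⟨_, ⟨ξ, rfl⟩, hd⟩ := Metric.mem_closure_iff.1 hk ε hε
    exact ⟨e ξ, ⟨ξ, rfl⟩, hd⟩
  let W : K →L[ℂ] H := (x : H →ₗ[ℂ] H).extendOfNorm e
  have hW : ∀ ξ, W (e ξ) = x ξ := fun ξ =>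
    LinearMap.extendOfNorm_eq he ⟨1, fun ξ => by rw [one_mul]; exact (hn ξ).le⟩ ξ
  have hWn : ∀ k, ‖W k‖ = ‖k‖ := by
    intro k
    refine he.induction_on (p := fun k => ‖W k‖ = ‖k‖) k
      (isClosed_eq (W.continuous.norm) continuous_norm) (fun ξ => ?_)
    rw [hW]; exact hn ξ
  let p : H →L[ℂ] H := K.starProjection
  let a : H →L[ℂ] H := W ∘L K.orthogonalProjectionOnto
  have hah : ∀ ξ, a (h ξ) = x ξ := by
    intro ξ
    have : K.orthogonalProjectionOnto (h ξ) = e ξ :=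
      Submodule.orthogonalProjectionOnto_mem_subspace_eq_self (K := K) (e ξ)
    change W (K.orthogonalProjectionOnto (h ξ)) = _
    rw [this, hW]
  have hp : IsStarProjection p := isStarProjection_starProjection
  have hap : a * p = a := by
    ext ξ
    change W (K.orthogonalProjectionOnto (K.orthogonalProjectionOnto ξ : H)) = _
    rw [Submodule.orthogonalProjectionOnto_mem_subspace_eq_self]
    rfl
  have hpK : ∀ ξ, p ξ ∈ K := fun ξ => (K.orthogonalProjectionOnto ξ).2
  have hpk : ∀ k ∈ K, p k = k := fun k hk => Submodule.starProjection_eq_self_iff.2 hk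
  have haa : star a * a = p := by
    rw [← sub_eq_zero]
    have : ∀ ξ, ⟪((star a * a - p : H →L[ℂ] H) : H →ₗ[ℂ] H) ξ, ξ⟫_ℂ = 0 := by
      intro ξ
      change ⟪(star a * a - p : H →L[ℂ] H) ξ, ξ⟫_ℂ = 0
      rw [sub_apply, inner_sub_left, ← norm_sq_of_star_mul, sub_eq_zero]
      have h1 : p = star p * p := by
        rw [hp.isSelfAdjoint.star_eq, hp.isIdempotentElem.eq]
      rw [h1, ← norm_sq_of_star_mul]
      congr 2
      exact hWn _
    have h0 := (inner_map_self_eq_zero _).1 this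
    ext ξ
    exact congrArg (fun f : H →ₗ[ℂ] H => f ξ) h0
  have hpN : p ∈ N := by
    rw [VonNeumannAlgebra.IsStarProjection.mem_iff hp]
    intro y hy
    have hr : p.range = K := by
      apply le_antisymm
      · rintro _ ⟨ξ, rfl⟩
        exact hpK ξ
      · intro k hk
        exact ⟨k, hpk k hk⟩
    rw [hr, Module.End.mem_invtSubmodule]
    apply Submodule.topologicalClosure_minimal
    · rintro _ ⟨ξ, rfl⟩
      change y (h ξ) ∈ K
      have : y (h ξ) = h (y ξ) := congrArg (fun f : H →L[ℂ] H => f ξ) (hN y hy)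
      rw [this]; exact hmem _
    · exact hKc.preimage y.continuous
  refine ⟨a, ?_, ?_, ?_, ?_, ?_⟩
  · apply vna_mem_of_comm
    intro y hy
    have h1 : ∀ k ∈ K, (y * a - a * y) k = 0 := by
      apply hKmin
      intro ξ
      have e1 : y (h ξ) = h (y ξ) := congrArg (fun f : H →L[ℂ] H => f ξ) (hN y hy)
      have e2 : x (y ξ) = y (x ξ) := congrArg (fun f : H →L[ℂ] H => f ξ) (vna_comm N hx hy)
      simp only [sub_apply, mul_apply_eq_comp]
      rw [hah, e1, hah, e2, sub_self]
    have h2 : (y * a - a * y) * p = 0 := by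
      ext ξ
      exact h1 _ (hpK ξ)
    have h3 := vna_comm N hpN hy
    have h4 : (y * a - a * y) * p = y * a - a * y := by
      rw [sub_mul, mul_assoc, hap, mul_assoc, ← h3, ← mul_assoc, hap]
    rw [← sub_eq_zero, ← h4, h2]
  · rw [mul_assoc, haa, hap]
  · intro hx0 ha0
    apply hx0
    ext ξ
    rw [← hah, ha0]; rfl
  · intro z hz
    have h1 : h * z = 0 := by
      ext ξ
      have : ‖x (z ξ)‖ = ‖h (z ξ)‖ := hn _
      have h2 : x (z ξ) = 0 := congrArg (fun f : H →L[ℂ] H => f ξ) hz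
      rw [h2, norm_zero] at this
      exact norm_eq_zero.1 this.symm
    have h2 : star z * h = 0 := by
      have := congrArg star h1
      rwa [star_mul, hsa, star_zero] at this
    have h3 : star z * p = 0 := by
      ext ξ
      exact hKmin (star z) (fun η => congrArg (fun f : H →L[ℂ] H => f η) h2) _ (hpK ξ)
    have h4 : p * z = 0 := by
      have := congrArg star h3
      rwa [star_mul, star_star, hp.isSelfAdjoint.star_eq, star_zero] at this
    rw [← hap, mul_assoc, h4, mul_zero]
  · intro z hz
    have h1 : z * a * p = 0 := by
      ext ξ
      refine hKmin (z * a) (fun η => ?_) _ (hpK ξ)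
      rw [mul_apply_eq_comp, hah]
      exact congrArg (fun f : H →L[ℂ] H => f η) hz
    rwa [mul_assoc, hap] at h1

theorem factor_link (N : VonNeumannAlgebra H) (hN : IsFactorSet (N : Set (H →L[ℂ] H)))
    (f e : H →L[ℂ] H) (hf : f ∈ N) (hf0 : f ≠ 0) (he0 : e ≠ 0) :
    ∃ y ∈ N, f * y * e ≠ 0 := by
  by_contra! hc
  let K : Submodule ℂ H :=
    { carrier := {ξ | ∀ y ∈ N, f (y ξ) = 0}
      add_mem' := by
        intro a b ha hb y hy
        rw [map_add, map_add, ha y hy, hb y hy, add_zero]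
      zero_mem' := by intro y _; simp
      smul_mem' := by
        intro c a ha y hy
        rw [map_smul, map_smul, ha y hy, smul_zero] }
  have hKc : IsClosed (K : Set H) := by
    have : (K : Set H) = ⋂ y ∈ N, {ξ | f (y ξ) = 0} := by
      ext ξ; simp [K]
    rw [this]
    refine isClosed_biInter fun y _ => ?_
    exact isClosed_eq (f.continuous.comp y.continuous) continuous_const
  have : CompleteSpace K := hKc.completeSpace_coe
  have hp : IsStarProjection K.starProjection := isStarProjection_starProjection
  have hr : K.starProjection.range = K := by
    apply le_antisymm
    · rintro _ ⟨ξ, rfl⟩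
      exact (K.orthogonalProjectionOnto ξ).2
    · intro k hk
      exact ⟨k, Submodule.starProjection_eq_self_iff.2 hk⟩
  have h1 : K.starProjection ∈ N := by
    rw [VonNeumannAlgebra.IsStarProjection.mem_iff hp, hr]
    intro y hy
    rw [Module.End.mem_invtSubmodule]
    intro ξ hξ z hz
    change f (z (y ξ)) = 0
    have e1 : z (y ξ) = y (z ξ) := congrArg (fun f : H →L[ℂ] H => f ξ) (vna_comm N hz hy)
    have e2 : f (y (z ξ)) = y (f (z ξ)) :=
      congrArg (fun f : H →L[ℂ] H => f (z ξ)) (vna_comm N hf hy)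
    rw [e1, e2, hξ z hz, map_zero]
  have h2 : K.starProjection ∈ N.commutant := by
    rw [VonNeumannAlgebra.IsStarProjection.mem_iff hp, hr, VonNeumannAlgebra.commutant_commutant]
    intro y hy
    rw [Module.End.mem_invtSubmodule]
    intro ξ hξ z hz
    exact hξ (z * y) (mul_mem hz hy)
  obtain ⟨c, hcc⟩ := hN _ h1 (fun x hx => (vna_comm N hx h2).symm)
  have h3 : ∀ ξ, e ξ ∈ K := fun ξ y hy =>
    congrArg (fun f : H →L[ℂ] H => f ξ) (hc y hy)
  obtain ⟨ξ, hξ⟩ : ∃ ξ, e ξ ≠ 0 := by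
    by_contra! h
    exact he0 (ContinuousLinearMap.ext h)
  have h4 : c • e ξ = e ξ := by
    have := Submodule.starProjection_eq_self_iff.2 (h3 ξ)
    rw [hcc] at this
    exact this
  have h5 : c = 1 := by
    have : (c - 1) • e ξ = 0 := by rw [sub_smul, h4, one_smul, sub_self]
    rcases smul_eq_zero.1 this with h | h
    · exact sub_eq_zero.1 h
    · exact absurd h hξ
  apply hf0
  ext η
  have h6 : η ∈ K := by
    rw [← Submodule.starProjection_eq_self_iff, hcc, h5, one_smul]; rfl
  exact h6 1 (one_mem N)


/-- Strong operator convergence along a filter. -/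
def SotTendsto {ι : Type*} (l : Filter ι) (a : ι → H →L[ℂ] H) (b : H →L[ℂ] H) : Prop :=
  ∀ ξ, Tendsto (fun i => a i ξ) l (nhds (b ξ))

theorem SotTendsto.mul {ι : Type*} {l : Filter ι} {a a' : ι → H →L[ℂ] H} {b b' : H →L[ℂ] H}
    (h : SotTendsto l a b) (h' : SotTendsto l a' b') (hb : ∀ i, ‖a i‖ ≤ 1) :
    SotTendsto l (fun i => a i * a' i) (b * b') := by
  intro ξ
  have h1 : Tendsto (fun i => a i (a' i ξ - b' ξ)) l (nhds 0) := by
    refine squeeze_zero_norm (a := fun i => ‖a' i ξ - b' ξ‖) (fun i => ?_) ?_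
    · exact ((a i).le_of_opNorm_le (hb i) _).trans_eq (one_mul _)
    · have := (h' ξ).sub_const (b' ξ)
      rw [sub_self] at this
      simpa using this.norm
  have h2 := h1.add (h (b' ξ))
  rw [zero_add] at h2
  refine h2.congr fun i => ?_
  rw [map_sub, sub_add_cancel]
  rfl

theorem SotTendsto.const {ι : Type*} {l : Filter ι} (b : H →L[ℂ] H) :
    SotTendsto l (fun _ => b) b := fun _ => tendsto_const_nhds

theorem SotTendsto.mul_const {ι : Type*} {l : Filter ι} {a : ι → H →L[ℂ] H} {b : H →L[ℂ] H}
    (h : SotTendsto l a b) (c : H →L[ℂ] H) :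
    SotTendsto l (fun i => a i * c) (b * c) := fun ξ => h (c ξ)

theorem SotTendsto.const_mul {ι : Type*} {l : Filter ι} {a : ι → H →L[ℂ] H} {b : H →L[ℂ] H}
    (h : SotTendsto l a b) (c : H →L[ℂ] H) :
    SotTendsto l (fun i => c * a i) (c * b) := fun ξ =>
  (c.continuous.tendsto _).comp (h ξ)

theorem SotTendsto.unique {ι : Type*} {l : Filter ι} [l.NeBot] {a : ι → H →L[ℂ] H}
    {b b' : H →L[ℂ] H} (h : SotTendsto l a b) (h' : SotTendsto l a b') : b = b' :=
  ContinuousLinearMap.ext fun ξ => tendsto_nhds_unique (h ξ) (h' ξ)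

theorem SotTendsto.mem {ι : Type*} {l : Filter ι} [l.NeBot] {a : ι → H →L[ℂ] H}
    {b : H →L[ℂ] H} (h : SotTendsto l a b) (N : VonNeumannAlgebra H) (ha : ∀ i, a i ∈ N) :
    b ∈ N := by
  apply vna_mem_of_comm
  intro y hy
  refine (h.const_mul y).unique ?_
  have : (fun i => y * a i) = fun i => a i * y := funext fun i => (vna_comm N (ha i) hy).symm
  rw [this]
  exact h.mul_const y

theorem SotTendsto.congr {ι : Type*} {l : Filter ι} {a a' : ι → H →L[ℂ] H}
    {b : H →L[ℂ] H} (h : SotTendsto l a b) (e : ∀ i, a i = a' i) : SotTendsto l a' b := by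
  rw [← funext e]; exact h

/-- The extension order on partial isometries. -/
def PExt (u w : H →L[ℂ] H) : Prop := star u * w = star u * u ∧ w * star u = u * star u

theorem PExt.adj {u w : H →L[ℂ] H} (h : PExt u w) : PExt (star u) (star w) := by
  constructor
  · have := congrArg Star.star h.2
    simpa using this
  · have := congrArg Star.star h.1
    simpa using this

theorem pisom_star {u : H →L[ℂ] H} (hu : u * star u * u = u) :
    star u * star (star u) * star u = star u := by
  have := congrArg star hu
  simpa [mul_assoc] using this

theorem PExt.eq_mul {u w : H →L[ℂ] H} (h : PExt u w) (hu : u * star u * u = u) :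
    w * (star u * u) = u := by
  rw [← mul_assoc, h.2, hu]

theorem pisom_norm_le {u : H →L[ℂ] H} (hu : u * star u * u = u) : ‖u‖ ≤ 1 := by
  have h1 : star (star u * u) * (star u * u) = star u * u := by
    rw [star_mul, star_star, mul_assoc, ← mul_assoc u, hu]
  have h2 := CStarRing.norm_star_mul_self (x := star u * u)
  rw [h1, CStarRing.norm_star_mul_self (x := u)] at h2
  by_contra! hc
  have h3 : 1 < ‖u‖ * ‖u‖ := by nlinarith
  nlinarith

/-- Pythagoras for the extension order. -/
theorem PExt.norm_sub_sq {u w : H →L[ℂ] H} (h : PExt u w) (hw : w * star w * w = w) (ξ : H) :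
    ‖w ξ - u ξ‖ ^ 2 = ‖w ξ‖ ^ 2 - ‖u ξ‖ ^ 2 := by
  have h1 : star (w - u) * (w - u) = star w * w - star u * u := by
    have e1 : star w * u = star u * u := by
      have := congrArg Star.star h.1
      simpa using this
    rw [star_sub, sub_mul, mul_sub, mul_sub, h.1, e1, sub_self, sub_zero]
  have h2 : ((‖w ξ - u ξ‖ ^ 2 : ℝ) : ℂ) = ((‖w ξ‖ ^ 2 - ‖u ξ‖ ^ 2 : ℝ) : ℂ) := by
    have := norm_sq_of_star_mul (w - u) ξ
    rw [h1, sub_apply (star w * w), inner_sub_left, ← norm_sq_of_star_mul,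
      ← norm_sq_of_star_mul] at this
    rw [Complex.ofReal_sub, ← this]
    rfl
  exact Complex.ofReal_injective h2

theorem PExt.trans {u w x : H →L[ℂ] H} (h : PExt u w) (h' : PExt w x)
    (hu : u * star u * u = u) : PExt u x := by
  have key : ∀ {u w x : H →L[ℂ] H}, PExt u w → PExt w x → u * star u * u = u →
      star u * x = star u * u := by
    intro u w x h h' hu
    have e1 := congrArg star (h.eq_mul hu)
    have e2 : star u * u * star w = star u := by simpa [mul_assoc] using e1
    calc star u * x = star u * u * star w * x := by rw [e2]
      _ = star u * u * (star w * w) := by rw [mul_assoc, h'.1]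
      _ = star u * w := by rw [← mul_assoc, e2]
      _ = _ := h.1
  refine ⟨key h h' hu, ?_⟩
  have := congrArg star (key h.adj h'.adj (pisom_star hu))
  simpa using this

/-- An increasing net of partial isometries converges strongly. -/
theorem pisom_net_limit {ι : Type*} [Preorder ι] [Nonempty ι] [IsDirectedOrder ι]
    (a : ι → H →L[ℂ] H) (ha : ∀ i, a i * star (a i) * a i = a i)
    (hmono : ∀ i j, i ≤ j → PExt (a i) (a j)) :
    ∃ b, SotTendsto atTop a b := by
  have hlim : ∀ ξ, ∃ η, Tendsto (fun i => a i ξ) atTop (nhds η) := by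
    intro ξ
    have hm : Monotone fun i => ‖a i ξ‖ ^ 2 := by
      intro i j hij
      have := (hmono i j hij).norm_sub_sq (ha j) ξ
      have h0 := sq_nonneg ‖a j ξ - a i ξ‖
      change ‖a i ξ‖ ^ 2 ≤ ‖a j ξ‖ ^ 2
      linarith
    have hb : BddAbove (Set.range fun i => ‖a i ξ‖ ^ 2) := by
      refine ⟨‖ξ‖ ^ 2, ?_⟩
      rintro _ ⟨i, rfl⟩
      have := ((a i).le_of_opNorm_le (pisom_norm_le (ha i)) ξ).trans_eq (one_mul _)
      exact pow_le_pow_left₀ (norm_nonneg _) this 2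
    have hs := isLUB_ciSup hb
    set s := ⨆ i, ‖a i ξ‖ ^ 2
    have hc : Cauchy (map (fun i => a i ξ) atTop) := by
      rw [Metric.cauchy_iff]
      refine ⟨inferInstance, fun ε hε => ?_⟩
      obtain ⟨_, ⟨i, rfl⟩, hi⟩ := hs.exists_between (b := s - (ε / 2) ^ 2)
        (by have : 0 < (ε / 2) ^ 2 := by positivity
            linarith)
      have hd : ∀ j, i ≤ j → ‖a j ξ - a i ξ‖ < ε / 2 := by
        intro j hij
        have h1 := (hmono i j hij).norm_sub_sq (ha j) ξ
        have h2 : ‖a j ξ‖ ^ 2 ≤ s := hs.1 ⟨j, rfl⟩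
        have h3 : ‖a j ξ - a i ξ‖ ^ 2 < (ε / 2) ^ 2 := by
          have := hi.1
          simp only at this
          linarith
        exact lt_of_pow_lt_pow_left₀ 2 (by positivity) h3
      refine ⟨(fun i => a i ξ) '' Set.Ici i, image_mem_map (Ici_mem_atTop i), ?_⟩
      rintro _ ⟨j, hj, rfl⟩ _ ⟨k, hk, rfl⟩
      have h1 := hd j hj
      have h2 := hd k hk
      rw [← dist_eq_norm] at h1 h2
      calc dist (a j ξ) (a k ξ) ≤ dist (a j ξ) (a i ξ) + dist (a k ξ) (a i ξ) :=
            dist_triangle_right _ _ _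
        _ < ε := by linarith
    exact CompleteSpace.complete hc
  choose f hf using hlim
  let L : H →ₗ[ℂ] H := linearMapOfTendsto (l := atTop) f (fun i => (a i : H →ₗ[ℂ] H))
    (tendsto_pi_nhds.2 hf)
  refine ⟨L.mkContinuous 1 (fun ξ => ?_), fun ξ => hf ξ⟩
  rw [one_mul]
  refine le_of_tendsto (hf ξ).norm (Eventually.of_forall fun i => ?_)
  exact ((a i).le_of_opNorm_le (pisom_norm_le (ha i)) ξ).trans_eq (one_mul _)

/-- Nonzero partial isometries in `M` implementing an isomorphism of corners of `P`, `Q`. -/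
structure GoodPI (M P Q : VonNeumannAlgebra H) (u : H →L[ℂ] H) : Prop where
  mem : u ∈ M
  pisom : u * star u * u = u
  ne : u ≠ 0
  fwd : ∀ x ∈ P, u * x * star u ∈ Q
  bwd : ∀ y ∈ Q, star u * y * u ∈ P

theorem goodPI_limit (M P Q : VonNeumannAlgebra H) {ι : Type*} [Preorder ι] [Nonempty ι]
    [IsDirectedOrder ι] (a : ι → H →L[ℂ] H) (ha : ∀ i, GoodPI M P Q (a i))
    (hmono : ∀ i j, i ≤ j → PExt (a i) (a j)) :
    ∃ b, GoodPI M P Q b ∧ ∀ i, PExt (a i) b := by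
  obtain ⟨b, hb⟩ := pisom_net_limit a (fun i => (ha i).pisom) hmono
  obtain ⟨c, hc⟩ := pisom_net_limit (fun i => star (a i)) (fun i => pisom_star (ha i).pisom)
    (fun i j hij => (hmono i j hij).adj)
  have hcb : c = star b := by
    rw [ContinuousLinearMap.star_eq_adjoint, ContinuousLinearMap.eq_adjoint_iff]
    intro ξ η
    have h1 := (hc ξ).inner (tendsto_const_nhds (x := η) (f := (atTop : Filter ι))) (𝕜 := ℂ)
    have h2 := (tendsto_const_nhds (x := ξ) (f := (atTop : Filter ι))).inner (hb η) (𝕜 := ℂ)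
    refine tendsto_nhds_unique h1 (h2.congr fun i => ?_)
    change _ = ⟪(star (a i)) ξ, η⟫_ℂ
    rw [ContinuousLinearMap.star_eq_adjoint, ContinuousLinearMap.adjoint_inner_left]
  subst hcb
  have hn : ∀ i, ‖a i‖ ≤ 1 := fun i => pisom_norm_le (ha i).pisom
  have hn' : ∀ i, ‖star (a i)‖ ≤ 1 := fun i => by rw [norm_star]; exact hn i
  have hext : ∀ i, PExt (a i) b := by
    intro i
    constructor
    · refine (hb.const_mul (star (a i))).unique (fun ξ => ?_)
      refine tendsto_const_nhds.congr' ?_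
      filter_upwards [Ici_mem_atTop i] with j hj
      rw [(hmono i j hj).1]
    · refine (hb.mul_const (star (a i))).unique (fun ξ => ?_)
      refine tendsto_const_nhds.congr' ?_
      filter_upwards [Ici_mem_atTop i] with j hj
      rw [(hmono i j hj).2]
  refine ⟨b, ⟨hb.mem M fun i => (ha i).mem, ?_, ?_, ?_, ?_⟩, hext⟩
  · have h1 := hb.mul (hc.mul hb hn') hn
    rw [mul_assoc]
    exact (h1.congr fun i => by rw [← mul_assoc, (ha i).pisom]).unique hb
  · rintro rfl
    obtain ⟨i⟩ := ‹Nonempty ι›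
    apply (ha i).ne
    rw [← (hext i).eq_mul (ha i).pisom, zero_mul]
  · intro x hx
    have h1 := hb.mul (hc.const_mul x) hn
    rw [mul_assoc]
    refine h1.mem Q fun i => ?_
    rw [← mul_assoc]
    exact (ha i).fwd x hx
  · intro y hy
    have h1 := hc.mul (hb.const_mul y) hn'
    rw [mul_assoc]
    refine h1.mem P fun i => ?_
    rw [← mul_assoc]
    exact (ha i).bwd y hy

/-- Bundled version of `GoodPI`, carrying the extension order. -/
structure GoodT (M P Q : VonNeumannAlgebra H) where
  val : H →L[ℂ] H
  prop : GoodPI M P Q val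

instance (M P Q : VonNeumannAlgebra H) : Preorder (GoodT M P Q) where
  le u w := PExt u.val w.val
  le_refl _ := ⟨rfl, rfl⟩
  le_trans u _ _ h h' := PExt.trans h h' u.prop.pisom

theorem goodPI_maximal (M P Q : VonNeumannAlgebra H) (v : H →L[ℂ] H) (hv : GoodPI M P Q v) :
    ∃ u, GoodPI M P Q u ∧ ∀ w, GoodPI M P Q w → PExt u w → PExt w u := by
  have : Nonempty (GoodT M P Q) := ⟨⟨v, hv⟩⟩
  obtain ⟨m, hm⟩ := zorn_le_nonempty (α := (GoodT M P Q)) (by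
    intro c hc hne
    have : Nonempty c := hne.to_subtype
    have : IsDirectedOrder c := ⟨fun (x y : c) => by
      rcases hc.total x.2 y.2 with h | h
      · exact ⟨y, h, le_refl y.1⟩
      · exact ⟨x, le_refl x.1, h⟩⟩
    obtain ⟨b, hb, hub⟩ := goodPI_limit M P Q (fun i : c => i.1.val) (fun i => i.1.prop)
      (fun i j hij => hij)
    exact ⟨⟨b, hb⟩, fun x hx => hub ⟨x, hx⟩⟩)
  exact ⟨m.val, m.prop, fun w hw h => hm (b := ⟨w, hw⟩) h⟩

theorem pisom_of_proj {v : H →L[ℂ] H} (h : star v * v * (star v * v) = star v * v) :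
    v * star v * v = v := by
  have h1 : star (v * star v * v - v) * (v * star v * v - v) = 0 := by
    simp only [star_sub, star_mul, star_star, sub_mul, mul_sub, ← mul_assoc] at h ⊢
    simp only [h, sub_self]
  exact sub_eq_zero.1 (CStarRing.star_mul_self_eq_zero_iff _ |>.1 h1)

/-- Extension step. -/
theorem goodPI_extend (M P Q : VonNeumannAlgebra H) (hPM : P ≤ M) (hQM : Q ≤ M)
    (hPfac : IsFactorSet (P : Set (H →L[ℂ] H))) (hQfac : IsFactorSet (Q : Set (H →L[ℂ] H)))
    (u : H →L[ℂ] H) (hu : GoodPI M P Q u) (he : star u * u ≠ 1) (hf : u * star u ≠ 1) :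
    ∃ w, GoodPI M P Q w ∧ PExt u w ∧ ¬ PExt w u := by
  have heP : star u * u ∈ P := by simpa using hu.bwd 1 (one_mem Q)
  have hfQ : u * star u ∈ Q := by simpa using hu.fwd 1 (one_mem P)
  have hus : star u * u * star u = star u := by simpa using pisom_star hu.pisom
  have he0 : star u * u ≠ 0 := fun h => hu.ne (CStarRing.star_mul_self_eq_zero_iff _ |>.1 h)
  obtain ⟨x, hx, hx0⟩ := factor_link P hPfac (1 - star u * u) (star u * u)
    (sub_mem (one_mem P) heP) (sub_ne_zero.2 he.symm) he0
  obtain ⟨a, haP, hapi, ha0, har, hal⟩ := polar_in_vna P _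
    (mul_mem (mul_mem (sub_mem (one_mem P) heP) hx) heP)
  replace ha0 := ha0 hx0
  have hae : a * (star u * u) = a := by
    have := har (1 - star u * u) (by
      rw [mul_assoc, mul_sub, mul_one, ← mul_assoc (star u * u), hus, sub_self, mul_zero])
    rw [mul_sub, mul_one, sub_eq_zero] at this
    exact this.symm
  have hea : star u * u * a = 0 := hal _ (by
    have h1 : star u * u * (1 - star u * u) = 0 := by
      rw [mul_sub, mul_one, ← mul_assoc (star u * u), hus, sub_self]
    rw [mul_assoc (1 - star u * u), ← mul_assoc (star u * u), h1, zero_mul])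
  have hua : u * a = 0 := by
    rw [← hu.pisom, mul_assoc u, mul_assoc u, hea, mul_zero]
  -- the image projection
  have hf1Q : u * (star a * a) * star u ∈ Q := hu.fwd _ (mul_mem (star_mem haP) haP)
  have hf1 : u * (star a * a) * star u = star (a * star u) * (a * star u) := by
    simp [mul_assoc]
  have hf10 : u * (star a * a) * star u ≠ 0 := by
    intro h
    rw [hf1] at h
    have h1 := CStarRing.star_mul_self_eq_zero_iff _ |>.1 h
    apply ha0
    rw [← hae, ← mul_assoc, h1, zero_mul]
  obtain ⟨y, hy, hy0⟩ := factor_link Q hQfac (1 - u * star u) (u * (star a * a) * star u)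
    (sub_mem (one_mem Q) hfQ) (sub_ne_zero.2 hf.symm) hf10
  obtain ⟨b, hbQ, hbpi, hb0, hbr, hbl⟩ := polar_in_vna Q _
    (mul_mem (mul_mem (sub_mem (one_mem Q) hfQ) hy) hf1Q)
  replace hb0 := hb0 hy0
  have hf1i : u * (star a * a) * star u * (u * (star a * a) * star u)
      = u * (star a * a) * star u := by
    calc _ = u * (star a * (a * (star u * u)) * (star a * a)) * star u := by noncomm_ring
      _ = u * (star a * (a * star a * a)) * star u := by rw [hae]; noncomm_ring
      _ = _ := by rw [hapi]
  have hbf1 : b * (u * (star a * a) * star u) = b := by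
    have := hbr (1 - u * (star a * a) * star u) (by
      rw [mul_assoc, mul_sub, mul_one, hf1i, sub_self, mul_zero])
    rw [mul_sub, mul_one, sub_eq_zero] at this
    exact this.symm
  have hfb : u * star u * b = 0 := hbl _ (by
    have h1 : u * star u * (1 - u * star u) = 0 := by
      rw [mul_sub, mul_one, ← mul_assoc (u * star u), hu.pisom, sub_self]
    rw [mul_assoc (1 - u * star u), ← mul_assoc (u * star u), h1, zero_mul])
  have hub : star u * b = 0 := by
    rw [← hus, mul_assoc (star u), mul_assoc (star u), hfb, mul_zero]
  have hbu : star b * u = 0 := by simpa using congrArg star hub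
  have hau : star a * star u = 0 := by simpa using congrArg star hua
  set c := b * u * star a with hcdef
  have hcs : star c = a * star u * star b := by simp [hcdef, mul_assoc]
  have hcc : c * star c = b * star b := by
    rw [hcs, hcdef]
    calc _ = b * (u * (star a * a) * star u) * star b := by noncomm_ring
      _ = _ := by rw [hbf1]
  have huc : star u * c = 0 := by rw [hcdef, ← mul_assoc, ← mul_assoc, hub, zero_mul, zero_mul]
  have hcu : c * star u = 0 := by rw [hcdef, mul_assoc, hau, mul_zero]
  have hsuc : star c * u = 0 := by simpa using congrArg star huc
  have hucs : u * star c = 0 := by simpa using congrArg star hcu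
  have hccc : c * star c * c = c := by
    rw [hcc, hcdef, ← mul_assoc, ← mul_assoc, hbpi]
  have hc0 : c ≠ 0 := by
    intro h
    rw [h, zero_mul] at hcc
    have := CStarRing.star_mul_self_eq_zero_iff (star b) |>.1 (by rw [star_star, ← hcc])
    exact hb0 (star_eq_zero.1 this)
  have hbfu : ∀ z ∈ P, u * z * star u ∈ Q := hu.fwd
  refine ⟨u + c, ⟨?_, ?_, ?_, ?_, ?_⟩, ⟨?_, ?_⟩, ?_⟩
  · exact add_mem hu.mem (mul_mem (mul_mem (hQM hbQ) hu.mem) (star_mem (hPM haP)))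
  · have h1 : (u + c) * star (u + c) = u * star u + c * star c := by
      rw [star_add, mul_add, add_mul, add_mul, hcu, hucs]; abel
    rw [h1, add_mul, mul_add, mul_add, hu.pisom, hccc, mul_assoc u, huc, mul_assoc c, hsuc]
    simp
  · intro h
    have h1 : star u * (u + c) = 0 := by rw [h, mul_zero]
    rw [mul_add, huc, add_zero] at h1
    exact he0 h1
  · intro z hz
    have h1 : (u + c) * z * star (u + c) = u * z * star u + b * (u * (star a * z) * star u)
        + (u * (z * a) * star u) * star b + b * (u * (star a * z * a) * star u) * star b := by
      rw [star_add, hcs, hcdef]; noncomm_ring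
    rw [h1]
    have hsa := star_mem haP
    have hsb := star_mem hbQ
    exact add_mem (add_mem (add_mem (hu.fwd _ hz) (mul_mem hbQ (hu.fwd _ (mul_mem hsa hz))))
      (mul_mem (hu.fwd _ (mul_mem hz haP)) hsb))
      (mul_mem (mul_mem hbQ (hu.fwd _ (mul_mem (mul_mem hsa hz) haP))) hsb)
  · intro z hz
    have h1 : star (u + c) * z * (u + c) = star u * z * u + (star u * (z * b) * u) * star a
        + a * (star u * (star b * z) * u) + a * (star u * (star b * z * b) * u) * star a := by
      rw [star_add, hcs, hcdef]; noncomm_ring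
    rw [h1]
    have hsa := star_mem haP
    have hsb := star_mem hbQ
    exact add_mem (add_mem (add_mem (hu.bwd _ hz) (mul_mem (hu.bwd _ (mul_mem hz hbQ)) hsa))
      (mul_mem haP (hu.bwd _ (mul_mem hsb hz))))
      (mul_mem (mul_mem haP (hu.bwd _ (mul_mem (mul_mem hsb hz) hbQ))) hsa)
  · rw [mul_add, huc, add_zero]
  · rw [add_mul, hcu, add_zero]
  · intro h
    have h1 := h.1
    rw [star_add, add_mul, hsuc, add_mul, mul_add, mul_add, huc, hsuc] at h1
    simp only [add_zero, zero_add] at h1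
    have h2 : star c * c = 0 := by simpa using h1
    exact hc0 (CStarRing.star_mul_self_eq_zero_iff _ |>.1 h2)

/-- In a tracial algebra isometries are unitary. -/
theorem tracial_finite (M : VonNeumannAlgebra H) (Ω : H) (hTr : IsTraceVector M Ω)
    (u : H →L[ℂ] H) (hu : u ∈ M) (h : star u * u = 1) : u * star u = 1 := by
  have hg : star (1 - u * star u) * (1 - u * star u) = 1 - u * star u := by
    have h1 : u * star u * (u * star u) = u * star u := by
      rw [mul_assoc, ← mul_assoc (star u), h, one_mul]
    rw [star_sub, star_one, star_mul, star_star, mul_sub, mul_one, sub_mul, one_mul, h1, sub_self,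
      sub_zero]
  have hM : 1 - u * star u ∈ M := sub_mem (one_mem M) (mul_mem hu (star_mem hu))
  have h2 := norm_sq_of_star_mul (1 - u * star u) Ω
  rw [hg, sub_apply, inner_sub_left, hTr.tracial u (star u) hu (star_mem hu), h, sub_self] at h2
  have h3 : ‖(1 - u * star u) Ω‖ ^ 2 = 0 := by exact_mod_cast h2
  have h4 := hTr.separating _ hM (norm_eq_zero.1 (pow_eq_zero_iff two_ne_zero |>.1 h3))
  exact (sub_eq_zero.1 h4).symm

end HelperLemmas

/-- subfactors of a tracial von Neumann algebra with unitarily conjugate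
corners are unitarily conjugate. -/
theorem statement9 (M : VonNeumannAlgebra H) (Ω : H) (hTr : IsTraceVector M Ω)
    (P Q : VonNeumannAlgebra H) (hPM : P ≤ M) (hQM : Q ≤ M)
    (hPfac : IsFactorSet (P : Set (H →L[ℂ] H))) (hQfac : IsFactorSet (Q : Set (H →L[ℂ] H)))
    (p q v : H →L[ℂ] H) (hp : p ∈ P) (hq : q ∈ Q) (hpProj : IsProj p) (hqProj : IsProj q)
    (hp0 : p ≠ 0) (hq0 : q ≠ 0) (hv : v ∈ M) (hvp : star v * v = p) (hvq : v * star v = q)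
    (hconj : (fun x => v * x * star v) '' corner p (P : Set (H →L[ℂ] H)) =
      corner q (Q : Set (H →L[ℂ] H))) :
    ∃ u : H →L[ℂ] H, unitaryIn M u ∧
      (fun x => u * x * star u) '' (P : Set (H →L[ℂ] H)) = (Q : Set (H →L[ℂ] H)) := by
  have hpp : p * p = p := hpProj.1.symm
  have hqq : q * q = q := hqProj.1.symm
  have hvpi : v * star v * v = v := pisom_of_proj (by rw [hvp, hpp])
  have hvP : v * p = v := by rw [← hvp, ← mul_assoc, hvpi]
  have hvQ : q * v = v := by rw [← hvq, hvpi]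
  have hvPs : p * star v = star v := by
    have := congrArg star hvP
    rwa [star_mul, hpProj.2.star_eq] at this
  have hvQs : star v * q = star v := by
    have := congrArg star hvQ
    rwa [star_mul, hqProj.2.star_eq] at this
  have hgood : GoodPI M P Q v := by
    refine ⟨hv, hvpi, ?_, ?_, ?_⟩
    · rintro rfl
      exact hp0 (by rw [← hvp, mul_zero])
    · intro x hx
      have h1 : v * (p * x * p) * star v ∈ corner q (Q : Set (H →L[ℂ] H)) := by
        rw [← hconj]
        exact ⟨_, ⟨x, hx, rfl⟩, rfl⟩
      obtain ⟨y, hy, hyx⟩ := h1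
      have h2 : v * (p * x * p) * star v = v * x * star v := by
        calc _ = (v * p) * x * (p * star v) := by noncomm_ring
          _ = _ := by rw [hvP, hvPs]
      rw [← h2, ← hyx]
      exact mul_mem (mul_mem hq hy) hq
    · intro y hy
      have h1 : q * y * q ∈ (fun x => v * x * star v) '' corner p (P : Set (H →L[ℂ] H)) := by
        rw [hconj]
        exact ⟨y, hy, rfl⟩
      obtain ⟨_, ⟨x, hx, rfl⟩, hyx⟩ := h1
      have h2 : star v * y * v = p * x * p := by
        calc star v * y * v = (star v * q) * y * (q * v) := by rw [hvQs, hvQ]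
          _ = star v * (q * y * q) * v := by noncomm_ring
          _ = star v * (v * (p * x * p) * star v) * v := by rw [← hyx]
          _ = (star v * v) * p * x * p * (star v * v) := by noncomm_ring
          _ = _ := by rw [hvp, hpp, mul_assoc, hpp]
      rw [h2]
      exact mul_mem (mul_mem hp hx) hp
  obtain ⟨u, hu, hmax⟩ := goodPI_maximal M P Q v hgood
  have hor : star u * u = 1 ∨ u * star u = 1 := by
    by_contra! hc
    obtain ⟨w, hw, h1, h2⟩ := goodPI_extend M P Q hPM hQM hPfac hQfac u hu hc.1 hc.2
    exact h2 (hmax w hw h1)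
  have hun : star u * u = 1 ∧ u * star u = 1 := by
    rcases hor with h | h
    · exact ⟨h, tracial_finite M Ω hTr u hu.mem h⟩
    · have := tracial_finite M Ω hTr (star u) (star_mem hu.mem) (by rwa [star_star])
      rw [star_star] at this
      exact ⟨this, h⟩
  refine ⟨u, ⟨hu.mem, hun.1, hun.2⟩, Set.Subset.antisymm ?_ ?_⟩
  · rintro _ ⟨x, hx, rfl⟩
    exact hu.fwd x hx
  · intro y hy
    refine ⟨star u * y * u, hu.bwd y hy, ?_⟩
    calc u * (star u * y * u) * star u = (u * star u) * y * (u * star u) := by noncomm_ring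
      _ = y := by rw [hun.2, one_mul, mul_one]

end
end

section
/- Let (M,τ) be a tracial von Neumann algebra and Q ≤ M a diffuse von Neumann subalgebra. Then the weak intertwining space wI_M(Q,Q) is contained in the anti-coarse space H_antic(Q ≤ M). -/
/-! # Common framework: tracial von Neumann algebras in standard form,
amenability, free group factors, 1-bounded entropy, bimodules. -/

noncomputable section

open scoped InnerProductSpace
open Filter

universe u

variable {H : Type u} [NormedAddCommGroup H] [InnerProductSpace ℂ H] [CompleteSpace H]

/-! ## Proof -/

section Proof12

theorem aux_smul_mem (Q : VonNeumannAlgebra H) (c : ℂ) {a : H →L[ℂ] H} (ha : a ∈ Q) :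
    c • a ∈ Q :=
  show c • a ∈ Q.toStarSubalgebra from Q.toStarSubalgebra.smul_mem ha c

theorem aux_inner_star (a : H →L[ℂ] H) (x y : H) : ⟪(star a) x, y⟫_ℂ = ⟪x, a y⟫_ℂ := by
  rw [ContinuousLinearMap.star_eq_adjoint, ContinuousLinearMap.adjoint_inner_left]

theorem aux_inner_star' (a : H →L[ℂ] H) (x y : H) : ⟪x, (star a) y⟫_ℂ = ⟪a x, y⟫_ℂ := by
  rw [ContinuousLinearMap.star_eq_adjoint, ContinuousLinearMap.adjoint_inner_right]

theorem aux_trace_inner {M : VonNeumannAlgebra H} {Ω : H} (hTr : IsTraceVector M Ω)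
    {a b : H →L[ℂ] H} (ha : a ∈ M) (hb : b ∈ M) :
    ⟪a Ω, b Ω⟫_ℂ = ⟪(star b) Ω, (star a) Ω⟫_ℂ := by
  have h := hTr.tracial (star b) a (star_mem hb) ha
  simp only [ContinuousLinearMap.mul_apply] at h
  rw [aux_inner_star] at h
  rw [h, aux_inner_star']

theorem aux_trace_norm {M : VonNeumannAlgebra H} {Ω : H} (hTr : IsTraceVector M Ω)
    {a : H →L[ℂ] H} (ha : a ∈ M) : ‖(star a) Ω‖ = ‖a Ω‖ := by
  have h := aux_trace_inner hTr ha ha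
  rw [inner_self_eq_norm_sq_to_K, inner_self_eq_norm_sq_to_K] at h
  have h2 : ‖a Ω‖ ^ 2 = ‖(star a) Ω‖ ^ 2 := by exact_mod_cast h
  exact ((sq_eq_sq₀ (norm_nonneg _) (norm_nonneg _)).1 h2).symm

/-- `‖a b Ω‖ ≤ ‖b‖ ‖a Ω‖` by traciality. -/
theorem aux_right_bound {M : VonNeumannAlgebra H} {Ω : H} (hTr : IsTraceVector M Ω)
    {a b : H →L[ℂ] H} (ha : a ∈ M) (hb : b ∈ M) : ‖(a * b) Ω‖ ≤ ‖b‖ * ‖a Ω‖ := by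
  rw [← aux_trace_norm hTr (mul_mem ha hb), star_mul, ContinuousLinearMap.mul_apply,
    ← aux_trace_norm hTr ha, ← norm_star b]
  exact ContinuousLinearMap.le_opNorm _ _

/-- Pythagoras for a projection. -/
theorem aux_proj_norm {p : H →L[ℂ] H} (hp : IsProj p) (v : H) :
    ‖v‖ ^ 2 = ‖p v‖ ^ 2 + ‖v - p v‖ ^ 2 := by
  have h : ⟪p v, v - p v⟫_ℂ = 0 := by
    rw [inner_sub_right, ← aux_inner_star p, hp.2.star_eq]
    have : p (p v) = p v := by
      conv_rhs => rw [hp.1]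
      rfl
    rw [this, sub_self]
  have := norm_add_sq_eq_norm_sq_add_norm_sq_of_inner_eq_zero _ _ h
  rw [add_sub_cancel] at this
  nlinarith

theorem aux_small {M : VonNeumannAlgebra H} {Ω : H}
    {A : VonNeumannAlgebra H} (hd : DiffuseSet (A : Set (H →L[ℂ] H)))
    (n : ℕ) (p : H →L[ℂ] H) (hp : p ∈ A) (hpp : IsProj p) (hp0 : p ≠ 0) :
    ∃ q ∈ A, IsProj q ∧ q ≠ 0 ∧ q * p = q ∧ 2 ^ n * ‖q Ω‖ ^ 2 ≤ ‖Ω‖ ^ 2 := by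
  induction n with
  | zero =>
    refine ⟨p, hp, hpp, hp0, hpp.1.symm, ?_⟩
    have := aux_proj_norm hpp Ω
    nlinarith [sq_nonneg ‖Ω - p Ω‖]
  | succ n ih =>
    obtain ⟨q, hq, hqp, hq0, hqle, hqn⟩ := ih
    obtain ⟨r, hr, hrp, hr0, hrne, hrq⟩ := hd q hq hqp hq0
    have hr : r ∈ A := hr
    have hqr : q * r = r := by
      have := congrArg star hrq
      rwa [star_mul, hrp.2.star_eq, hqp.2.star_eq] at this
    have hsq : (q - r) Ω = q Ω - r (q Ω) := by
      rw [← ContinuousLinearMap.mul_apply, hrq]; rfl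
    have hsum := aux_proj_norm hrp (q Ω)
    rw [← hsq, ← ContinuousLinearMap.mul_apply, hrq] at hsum
    have h2 : (2:ℝ) ^ n > 0 := by positivity
    by_cases hle : ‖r Ω‖ ^ 2 ≤ ‖(q - r) Ω‖ ^ 2
    · refine ⟨r, hr, hrp, hr0, ?_, ?_⟩
      · rw [← hrq, mul_assoc, hqle]
      · rw [pow_succ]; nlinarith
    · refine ⟨q - r, sub_mem hq hr, ⟨?_, hqp.2.sub hrp.2⟩, sub_ne_zero.2 hrne.symm, ?_, ?_⟩
      · rw [mul_sub, sub_mul, sub_mul, hrq, hqr, ← hqp.1, ← hrp.1, sub_self, sub_zero]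
      · rw [sub_mul, hqle, ← hrq, mul_assoc, hqle]
      · rw [pow_succ]; nlinarith

/-- Fine almost-partitions of unity by projections in a diffuse algebra. -/
theorem aux_partition {Ω : H} {A : VonNeumannAlgebra H}
    (hd : DiffuseSet (A : Set (H →L[ℂ] H))) (δ ε : ℝ) (hδ : 0 < δ) (hε : 0 < ε) :
    ∃ F : Finset (H →L[ℂ] H), (∀ p ∈ F, p ∈ A ∧ IsProj p ∧ ‖p Ω‖ ^ 2 ≤ δ) ∧
      (∀ p ∈ F, ∀ q ∈ F, p ≠ q → p * q = 0) ∧ ‖Ω - ∑ p ∈ F, p Ω‖ ≤ ε := by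
  classical
  let 𝒮 : Set (Set (H →L[ℂ] H)) := {S | (∀ p ∈ S, p ∈ A ∧ IsProj p ∧ p ≠ 0 ∧ ‖p Ω‖ ^ 2 ≤ δ) ∧
      ∀ p ∈ S, ∀ q ∈ S, p ≠ q → p * q = 0}
  obtain ⟨S, hS⟩ : ∃ S, Maximal (· ∈ 𝒮) S := by
    apply zorn_subset
    intro c hc hch
    refine ⟨⋃₀ c, ⟨?_, ?_⟩, fun s hs => Set.subset_sUnion_of_mem hs⟩
    · rintro p ⟨s, hs, hps⟩
      exact (hc hs).1 p hps
    · rintro p ⟨s, hs, hps⟩ q ⟨t, ht, hqt⟩ hne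
      rcases hch.total hs ht with h | h
      · exact (hc ht).2 p (h hps) q hqt hne
      · exact (hc hs).2 p hps q (h hqt) hne
  have hS1 := hS.prop.1
  have hS2 := hS.prop.2
  -- the common kernel
  let U : Submodule ℂ H := ⨅ p ∈ S, LinearMap.ker (p : H →L[ℂ] H).toLinearMap
  have memU : ∀ v, v ∈ U ↔ ∀ p ∈ S, p v = 0 := by
    intro v; simp [U, Submodule.mem_iInf]
  have hUc : IsClosed (U : Set H) := by
    have : (U : Set H) = ⋂ p ∈ S, {v | p v = 0} := by
      ext v; simp [memU]
    rw [this]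
    exact isClosed_biInter fun p _ => isClosed_eq p.continuous continuous_const
  haveI : CompleteSpace U := hUc.completeSpace_coe
  have hU : U = ⊥ := by
    by_contra hne
    let r := U.starProjection
    have hr : IsStarProjection r := isStarProjection_starProjection
    have hrA : r ∈ A := by
      rw [VonNeumannAlgebra.IsStarProjection.mem_iff hr]
      intro y hy
      rw [VonNeumannAlgebra.mem_commutant_iff] at hy
      have hrange : r.range = U := Submodule.range_starProjection U
      rw [hrange]
      intro v hv
      have hv := (memU v).1 hv
      refine (memU _).2 fun p hp => ?_
      have := congrArg (fun z : H →L[ℂ] H => z v) (hy p (hS1 p hp).1)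
      simp only [ContinuousLinearMap.mul_apply, hv p hp, map_zero] at this
      exact this
    have hr0 : r ≠ 0 := by
      intro h0
      apply hne
      rw [← Submodule.range_starProjection U]
      change r.range = ⊥
      rw [h0]; simp
    have hpr : ∀ p ∈ S, p * r = 0 := by
      intro p hp
      ext v
      exact (memU _).1 (Submodule.starProjection_apply_mem U v) p hp
    obtain ⟨n, hn⟩ := exists_nat_gt (‖Ω‖ ^ 2 / δ)
    have hn2 : ‖Ω‖ ^ 2 ≤ 2 ^ n * δ := by
      rw [div_lt_iff₀ hδ] at hn
      have : (n : ℝ) ≤ 2 ^ n := by exact_mod_cast Nat.lt_two_pow_self.le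
      nlinarith
    obtain ⟨q, hq, hqp, hq0, hqr, hqn⟩ := aux_small (M := A) (Ω := Ω) hd n r hrA
      ⟨hr.isIdempotentElem.symm, hr.isSelfAdjoint⟩ hr0
    have hqδ : ‖q Ω‖ ^ 2 ≤ δ := by
      have h2 : (2:ℝ) ^ n > 0 := by positivity
      exact le_of_mul_le_mul_left (hqn.trans hn2) h2
    have hrq : r * q = q := by
      have := congrArg star hqr
      rwa [star_mul, hqp.2.star_eq, hr.isSelfAdjoint.star_eq] at this
    have hpq : ∀ p ∈ S, p * q = 0 := by
      intro p hp
      rw [← hrq, ← mul_assoc, hpr p hp, zero_mul]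
    have hqp' : ∀ p ∈ S, q * p = 0 := by
      intro p hp
      have := congrArg star (hpq p hp)
      rwa [star_mul, hqp.2.star_eq, (hS1 p hp).2.1.2.star_eq, star_zero] at this
    have hmem : insert q S ∈ 𝒮 := by
      refine ⟨?_, ?_⟩
      · intro p hp
        rcases hp with rfl | hp
        · exact ⟨hq, hqp, hq0, hqδ⟩
        · exact hS1 p hp
      · rintro p (rfl | hp) p' (rfl | hp') hne
        · exact absurd rfl hne
        · exact hqp' _ hp'
        · exact hpq _ hp
        · exact hS2 _ hp _ hp' hne
    have hqS : q ∈ S := hS.le_of_ge hmem (Set.subset_insert _ _) (Set.mem_insert _ _)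
    have := hpq q hqS
    rw [← hqp.1] at this
    exact hq0 this
  -- density
  let X : Submodule ℂ H := Submodule.span ℂ {v | ∃ p ∈ S, p v = v}
  have hX : X.topologicalClosure = ⊤ := by
    rw [Submodule.topologicalClosure_eq_top_iff, eq_bot_iff, ← hU]
    intro v hv
    refine (memU v).2 fun p hp => ?_
    have hpp := (hS1 p hp).2.1
    rw [Submodule.mem_orthogonal] at hv
    have hp2 : p (p v) = p v := by
      conv_rhs => rw [hpp.1]
      rfl
    have h1 := hv (p v) (Submodule.subset_span ⟨p, hp, hp2⟩)
    rw [← hp2, ← aux_inner_star' p, hpp.2.star_eq] at h1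
    exact inner_self_eq_zero.1 h1
  have hΩ : Ω ∈ closure (X : Set H) := by
    rw [← Submodule.topologicalClosure_coe, hX]; trivial
  obtain ⟨g, hg, hgd⟩ := Metric.mem_closure_iff.1 hΩ ε hε
  have key : ∀ g ∈ X, ∃ F : Finset (H →L[ℂ] H), (F : Set (H →L[ℂ] H)) ⊆ S ∧
      ∀ G : Finset (H →L[ℂ] H), (G : Set (H →L[ℂ] H)) ⊆ S → F ⊆ G → ∑ p ∈ G, p g = g := by
    intro g hg
    induction hg using Submodule.span_induction with
    | mem x hx =>
      obtain ⟨p, hp, hpx⟩ := hx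
      refine ⟨{p}, by simpa using hp, fun G hG hpG => ?_⟩
      rw [Finset.sum_eq_single_of_mem p (hpG (by simp)), hpx]
      intro q hq hne
      rw [← hpx, ← ContinuousLinearMap.mul_apply, hS2 q (hG hq) p hp hne]; rfl
    | zero => exact ⟨∅, by simp, by simp⟩
    | add x y _ _ hx hy =>
      obtain ⟨F1, h1, h1'⟩ := hx
      obtain ⟨F2, h2, h2'⟩ := hy
      refine ⟨F1 ∪ F2, by simp [h1, h2], fun G hG hFG => ?_⟩
      simp only [map_add, Finset.sum_add_distrib]
      rw [h1' G hG (Finset.union_subset_left hFG), h2' G hG (Finset.union_subset_right hFG)]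
    | smul c x _ hx =>
      obtain ⟨F1, h1, h1'⟩ := hx
      refine ⟨F1, h1, fun G hG hFG => ?_⟩
      simp only [map_smul, ← Finset.smul_sum]
      rw [h1' G hG hFG]
  obtain ⟨F, hFS, hF⟩ := key g hg
  refine ⟨F, fun p hp => ⟨(hS1 p (hFS hp)).1, (hS1 p (hFS hp)).2.1, (hS1 p (hFS hp)).2.2.2⟩,
    fun p hp q hq => hS2 p (hFS hp) q (hFS hq), ?_⟩
  have hFF := hF F hFS subset_rfl
  have hPp : IsProj (∑ p ∈ F, p) := by
    refine ⟨?_, ?_⟩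
    · rw [Finset.sum_mul_sum]
      refine Finset.sum_congr rfl fun p hp => ?_
      rw [Finset.sum_eq_single_of_mem p hp]
      · exact (hS1 p (hFS hp)).2.1.1
      · intro q hq hne
        exact hS2 p (hFS hp) q (hFS hq) hne.symm
    · exact isSelfAdjoint_sum F fun p hp => (hS1 p (hFS hp)).2.1.2
  have h3 := aux_proj_norm hPp (Ω - g)
  have h4 : (Ω - g) - (∑ p ∈ F, p) (Ω - g) = Ω - ∑ p ∈ F, p Ω := by
    simp only [ContinuousLinearMap.sum_apply, map_sub, Finset.sum_sub_distrib, hFF]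
    abel
  rw [h4] at h3
  have h5 : ‖Ω - ∑ p ∈ F, p Ω‖ ≤ ‖Ω - g‖ :=
    abs_le_of_sq_le_sq' (by nlinarith [sq_nonneg ‖(∑ p ∈ F, p) (Ω - g)‖]) (norm_nonneg _) |>.2
  rw [dist_eq_norm] at hgd
  exact h5.trans hgd.le

section Coarse

variable {M Q : VonNeumannAlgebra H} {Ω : H} (W : CoarseBimodule M Ω (Q : Set (H →L[ℂ] H)))

theorem cb_ext {v w : W.K} (h : ∀ a ∈ Q, ∀ b ∈ Q, ⟪W.vec a b, v⟫_ℂ = ⟪W.vec a b, w⟫_ℂ) :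
    v = w := by
  rw [← sub_eq_zero]
  refine W.dense_span.eq_zero_of_inner_right (𝕜 := ℂ) fun x hx => ?_
  induction hx using Submodule.span_induction with
  | mem x hx =>
    obtain ⟨a, ha, b, hb, rfl⟩ := hx
    rw [inner_sub_right, h a ha b hb, sub_self]
  | zero => simp
  | add x y _ _ hx hy => rw [inner_add_left, hx, hy, add_zero]
  | smul c x _ hx => rw [inner_smul_left, hx, mul_zero]

/-- Two continuous linear maps agreeing on elementary tensors are equal. -/
theorem cb_hom_ext {S T : W.K →L[ℂ] W.K}
    (h : ∀ a ∈ Q, ∀ b ∈ Q, S (W.vec a b) = T (W.vec a b)) : S = T := by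
  refine ContinuousLinearMap.ext_on W.dense_span ?_
  rintro x ⟨a, ha, b, hb, rfl⟩
  exact h a ha b hb

theorem cb_norm {a b : H →L[ℂ] H} (ha : a ∈ Q) (hb : b ∈ Q) :
    ‖W.vec a b‖ = ‖a Ω‖ * ‖b Ω‖ := by
  have h := W.inner_vec a b a b ha hb ha hb
  rw [inner_self_eq_norm_sq_to_K, inner_self_eq_norm_sq_to_K, inner_self_eq_norm_sq_to_K] at h
  have h2 : ‖W.vec a b‖ ^ 2 = (‖a Ω‖ * ‖b Ω‖) ^ 2 := by
    rw [mul_pow]; exact_mod_cast h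
  exact (sq_eq_sq₀ (norm_nonneg _) (by positivity)).1 h2

theorem cb_smul {a b : H →L[ℂ] H} (c : ℂ) (ha : a ∈ Q) (hb : b ∈ Q) :
    c • W.vec a b = W.vec a (c • b) := by
  refine cb_ext W fun x hx y hy => ?_
  rw [inner_smul_right, W.inner_vec _ _ _ _ hx hy ha hb,
    W.inner_vec _ _ _ _ hx hy ha (aux_smul_mem Q c hb)]
  simp only [ContinuousLinearMap.smul_apply, inner_smul_right]
  ring

theorem cb_lact_mul {x y : H →L[ℂ] H} (hx : x ∈ Q) (hy : y ∈ Q) (v : W.K) :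
    W.lact x (W.lact y v) = W.lact (x * y) v := by
  have : (W.lact x).comp (W.lact y) = W.lact (x * y) := by
    refine cb_hom_ext W fun a ha b hb => ?_
    rw [ContinuousLinearMap.comp_apply, W.lact_vec _ _ _ hy ha hb,
      W.lact_vec _ _ _ hx (mul_mem hy ha) hb, W.lact_vec _ _ _ (mul_mem hx hy) ha hb, mul_assoc]
  exact congrArg (fun T : W.K →L[ℂ] W.K => T v) this

theorem cb_ract_mul {x y : H →L[ℂ] H} (hx : x ∈ Q) (hy : y ∈ Q) (v : W.K) :
    W.ract x (W.ract y v) = W.ract (y * x) v := by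
  have : (W.ract x).comp (W.ract y) = W.ract (y * x) := by
    refine cb_hom_ext W fun a ha b hb => ?_
    rw [ContinuousLinearMap.comp_apply, W.ract_vec _ _ _ hy ha hb,
      W.ract_vec _ _ _ hx ha (mul_mem hb hy), W.ract_vec _ _ _ (mul_mem hy hx) ha hb, mul_assoc]
  exact congrArg (fun T : W.K →L[ℂ] W.K => T v) this

theorem cb_lact_zero (v : W.K) : W.lact 0 v = 0 := by
  have : W.lact 0 = 0 := by
    refine cb_hom_ext W fun a ha b hb => ?_
    rw [W.lact_vec _ _ _ (zero_mem Q) ha hb, zero_mul, ContinuousLinearMap.zero_apply,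
      ← norm_eq_zero, cb_norm W (zero_mem Q) hb]
    simp
  rw [this]; rfl

theorem cb_lact_one (v : W.K) : W.lact 1 v = v := by
  have : W.lact 1 = ContinuousLinearMap.id ℂ W.K := by
    refine cb_hom_ext W fun a ha b hb => ?_
    rw [W.lact_vec _ _ _ (one_mem Q) ha hb, one_mul]; rfl
  rw [this]; rfl

theorem cb_lact_adj {x : H →L[ℂ] H} (hx : x ∈ Q) (v w : W.K) :
    ⟪W.lact x v, w⟫_ℂ = ⟪v, W.lact (star x) w⟫_ℂ := by
  have : (W.lact x) = ContinuousLinearMap.adjoint (W.lact (star x)) := by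
    refine cb_hom_ext W fun a ha b hb => cb_ext W fun c hc d hd => ?_
    rw [ContinuousLinearMap.adjoint_inner_right, W.lact_vec _ _ _ hx ha hb,
      W.lact_vec _ _ _ (star_mem hx) hc hd, W.inner_vec _ _ _ _ hc hd (mul_mem hx ha) hb,
      W.inner_vec _ _ _ _ (mul_mem (star_mem hx) hc) hd ha hb]
    simp only [mul_apply_eq_comp, aux_inner_star]
  rw [this, ContinuousLinearMap.adjoint_inner_left]

theorem cb_ract_adj (hTr : IsTraceVector M Ω) (hQ : Q ≤ M) {x : H →L[ℂ] H} (hx : x ∈ Q)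
    (v w : W.K) : ⟪W.ract x v, w⟫_ℂ = ⟪v, W.ract (star x) w⟫_ℂ := by
  have : (W.ract x) = ContinuousLinearMap.adjoint (W.ract (star x)) := by
    refine cb_hom_ext W fun a ha b hb => cb_ext W fun c hc d hd => ?_
    rw [ContinuousLinearMap.adjoint_inner_right, W.ract_vec _ _ _ hx ha hb,
      W.ract_vec _ _ _ (star_mem hx) hc hd, W.inner_vec _ _ _ _ hc hd ha (mul_mem hb hx),
      W.inner_vec _ _ _ _ hc (mul_mem hd (star_mem hx)) ha hb]
    congr 1
    rw [aux_trace_inner hTr (hQ hd) (hQ (mul_mem hb hx)),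
      aux_trace_inner hTr (hQ (mul_mem hd (star_mem hx))) (hQ hb)]
    simp only [star_mul, star_star, mul_apply_eq_comp, aux_inner_star]
  rw [this, ContinuousLinearMap.adjoint_inner_left]

end Coarse

/-- The invertible square root of `h + ε` inside a von Neumann algebra. -/
theorem aux_sqrt (Q : VonNeumannAlgebra H) {h : H →L[ℂ] H} (hh : h ∈ Q) (h0 : 0 ≤ h)
    {ε : ℝ} (hε : 0 < ε) :
    ∃ s ∈ Q, ∃ t ∈ Q, IsSelfAdjoint s ∧ s * t = 1 ∧ s * s = h + (ε : ℂ) • 1 := by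
  set k : H →L[ℂ] H := h + (ε : ℂ) • 1 with hk
  have hkQ : k ∈ Q := add_mem hh (aux_smul_mem Q _ (one_mem Q))
  have h1 : IsStrictlyPositive ((ε : ℂ) • (1 : H →L[ℂ] H)) := by
    have : (ε : ℂ) • (1 : H →L[ℂ] H) = algebraMap ℝ (H →L[ℂ] H) ε := by
      rw [Algebra.algebraMap_eq_smul_one]; rfl
    rw [this]
    exact isStrictlyPositive_algebraMap hε
  have hkp : IsStrictlyPositive k := IsStrictlyPositive.nonneg_add h0 h1
  have hs : CFC.sqrt k * CFC.sqrt k = k := CFC.sqrt_mul_sqrt_self k hkp.nonneg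
  have hu : IsUnit (CFC.sqrt k) := hkp.isUnit_cfcSqrt
  have hsa : IsSelfAdjoint (CFC.sqrt k) := (CFC.sqrt_nonneg k).isSelfAdjoint
  have hmem : ∀ z : H →L[ℂ] H, (∀ y ∈ Q.commutant, y * z = z * y) → z ∈ Q := by
    intro z hz
    rw [← Q.commutant_commutant, VonNeumannAlgebra.mem_commutant_iff]
    exact hz
  have hcomm : ∀ y ∈ Q.commutant, Commute (CFC.sqrt k) y := by
    intro y hy
    have : Commute k y := VonNeumannAlgebra.mem_commutant_iff.1 hy k hkQ
    exact this.cfcₙ_nnreal _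
  obtain ⟨t, ht⟩ := hu.exists_right_inv
  refine ⟨CFC.sqrt k, hmem _ fun y hy => (hcomm y hy).symm, t, hmem _ fun y hy => ?_, hsa, ht, hs⟩
  have hc := hcomm y hy
  apply hu.mul_left_cancel
  rw [← mul_assoc, ← mul_assoc, ht, one_mul, hc.eq, mul_assoc, ht, mul_one]

section Core

theorem aux_inner_self {E : Type*} [NormedAddCommGroup E] [InnerProductSpace ℂ E] (v : E) :
    ⟪v, v⟫_ℂ = ((‖v‖ ^ 2 : ℝ) : ℂ) := by
  rw [inner_self_eq_norm_sq_to_K]; simp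

variable {M Q : VonNeumannAlgebra H} {Ω : H} (W : CoarseBimodule M Ω (Q : Set (H →L[ℂ] H)))

/-- Core inequality, for `η = ∑ vec (a k) (b k)`. -/
theorem core_finite (hTr : IsTraceVector M Ω) (hQ : Q ≤ M) {n : ℕ}
    (a b : Fin n → H →L[ℂ] H) (ha : ∀ k, a k ∈ Q) (hb : ∀ k, b k ∈ Q)
    {ι : Type*} (F : Finset ι) (x : ι → H →L[ℂ] H) (hx : ∀ j ∈ F, x j ∈ Q)
    (horth : ∀ i ∈ F, ∀ j ∈ F, i ≠ j → ⟪x i Ω, x j Ω⟫_ℂ = 0)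
    (γ : ℝ) (hγ : 0 ≤ γ) (hxγ : ∀ j ∈ F, ‖x j Ω‖ ^ 2 ≤ γ)
    (y : H →L[ℂ] H) (hy : y ∈ Q)
    (d : ι → H →L[ℂ] H) (hd : ∀ j ∈ F, d j ∈ Q) :
    ‖∑ j ∈ F, ⟪W.vec (x j) y, W.ract (d j) (∑ k, W.vec (a k) (b k))⟫_ℂ‖ ^ 2 ≤
      γ * ‖y‖ ^ 2 * ∑ j ∈ F, ‖W.ract (d j) (∑ k, W.vec (a k) (b k))‖ ^ 2 := by
  classical
  set η : W.K := ∑ k, W.vec (a k) (b k) with hη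
  have hηr : ∀ c ∈ Q, W.ract c η = ∑ k, W.vec (a k) (b k * c) := by
    intro c hc
    rw [hη, map_sum]
    exact Finset.sum_congr rfl fun k _ => W.ract_vec c _ _ hc (ha k) (hb k)
  let h : H →L[ℂ] H := ∑ k, ∑ l, ⟪a k Ω, a l Ω⟫_ℂ • (star (b k) * b l)
  have hhQ : h ∈ Q := sum_mem fun k _ => sum_mem fun l _ =>
    aux_smul_mem Q _ (mul_mem (star_mem (hb k)) (hb l))
  have hhv : ∀ v w : H, ⟪v, h w⟫_ℂ = ∑ k, ∑ l, ⟪a k Ω, a l Ω⟫_ℂ * ⟪b k v, b l w⟫_ℂ := by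
    intro v w
    simp only [h, sum_apply, smul_apply, inner_sum, inner_smul_right, mul_apply_eq_comp,
      aux_inner_star']
  have h0 : 0 ≤ h := by
    rw [ContinuousLinearMap.nonneg_iff_isPositive, ContinuousLinearMap.isPositive_iff_complex]
    intro v
    have e1 : ⟪v, h v⟫_ℂ = ⟪∑ k, (a k Ω) ⊗ₜ[ℂ] (b k v), ∑ k, (a k Ω) ⊗ₜ[ℂ] (b k v)⟫_ℂ := by
      simp only [hhv, sum_inner, inner_sum, TensorProduct.inner_tmul]
      exact Finset.sum_comm
    have e3 := e1.trans (aux_inner_self (∑ k, (a k Ω) ⊗ₜ[ℂ] (b k v)))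
    have e2 : ⟪h v, v⟫_ℂ = ((‖∑ k, (a k Ω) ⊗ₜ[ℂ] (b k v)‖ ^ 2 : ℝ) : ℂ) := by
      rw [← inner_conj_symm, e3]; simp
    rw [e2]
    refine ⟨by rw [RCLike.re_to_complex, Complex.ofReal_re], ?_⟩
    simp only [RCLike.re_to_complex, Complex.ofReal_re]
    positivity
  have hηn : ∀ c ∈ Q, ((‖W.ract c η‖ ^ 2 : ℝ) : ℂ) = ⟪c Ω, h (c Ω)⟫_ℂ := by
    intro c hc
    have : ⟪W.ract c η, W.ract c η⟫_ℂ = ⟪c Ω, h (c Ω)⟫_ℂ := by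
      rw [hηr c hc, hhv, sum_inner]
      refine Finset.sum_congr rfl fun k _ => ?_
      rw [inner_sum]
      refine Finset.sum_congr rfl fun l _ => ?_
      rw [W.inner_vec _ _ _ _ (ha k) (mul_mem (hb k) hc) (ha l) (mul_mem (hb l) hc)]
      rfl
    rw [← this, aux_inner_self]
  -- slices
  let io : ι → H →L[ℂ] H := fun j => ∑ k, ⟪x j Ω, a k Ω⟫_ℂ • b k
  have hioQ : ∀ j, io j ∈ Q := fun j => sum_mem fun k _ => aux_smul_mem Q _ (hb k)
  have hio : ∀ j ∈ F, ∀ z ∈ Q, ∀ c ∈ Q,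
      ⟪W.vec (x j) z, W.ract c η⟫_ℂ = ⟪z Ω, (io j * c) Ω⟫_ℂ := by
    intro j hj z hz c hc
    rw [hηr c hc]
    simp only [inner_sum, io, mul_apply_eq_comp, sum_apply, smul_apply, inner_smul_right]
    refine Finset.sum_congr rfl fun k _ => ?_
    rw [W.inner_vec _ _ _ _ (hx j hj) hz (ha k) (mul_mem (hb k) hc)]
    rfl
  have main : ∀ ε : ℝ, 0 < ε →
      ‖∑ j ∈ F, ⟪W.vec (x j) y, W.ract (d j) η⟫_ℂ‖ ^ 2 ≤
      γ * ‖y‖ ^ 2 * (∑ j ∈ F, ‖W.ract (d j) η‖ ^ 2 + ε * ∑ j ∈ F, ‖d j Ω‖ ^ 2) := by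
    intro ε hε
    obtain ⟨s, hsQ, t, htQ, hsa, hst, hss⟩ := aux_sqrt Q hhQ h0 hε
    have hsn : ∀ c ∈ Q, ‖(s * c) Ω‖ ^ 2 = ‖W.ract c η‖ ^ 2 + ε * ‖c Ω‖ ^ 2 := by
      intro c hc
      have e1 : ⟪(s * c) Ω, (s * c) Ω⟫_ℂ = ⟪c Ω, (s * s) (c Ω)⟫_ℂ := by
        simp only [mul_apply_eq_comp]
        rw [← aux_inner_star s (c Ω), hsa.star_eq, ← aux_inner_star s (s (c Ω)), hsa.star_eq]
      rw [hss, add_apply, inner_add_right, ← hηn c hc, smul_apply, inner_smul_right,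
        one_apply_eq_self, aux_inner_self, aux_inner_self] at e1
      exact_mod_cast e1
    have hηt : ‖W.ract t η‖ ^ 2 ≤ 1 := by
      have := hsn t htQ
      rw [hst] at this
      have e : ‖(1 : H →L[ℂ] H) Ω‖ = 1 := hTr.norm_one
      rw [e] at this
      nlinarith [mul_nonneg hε.le (sq_nonneg ‖t Ω‖)]
    let z : ι → H →L[ℂ] H := fun j => io j * t
    have hzQ : ∀ j, z j ∈ Q := fun j => mul_mem (hioQ j) htQ
    -- Bessel
    set Z : ℝ := ∑ j ∈ F, ‖z j Ω‖ ^ 2 with hZ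
    have hZ0 : 0 ≤ Z := Finset.sum_nonneg fun _ _ => sq_nonneg _
    have hsum : ‖∑ j ∈ F, W.vec (x j) (z j)‖ ^ 2 ≤ γ * Z := by
      have e1 : ⟪∑ j ∈ F, W.vec (x j) (z j), ∑ j ∈ F, W.vec (x j) (z j)⟫_ℂ =
          ((∑ j ∈ F, ‖x j Ω‖ ^ 2 * ‖z j Ω‖ ^ 2 : ℝ) : ℂ) := by
        rw [sum_inner, Complex.ofReal_sum]
        refine Finset.sum_congr rfl fun j hj => ?_
        rw [inner_sum, Finset.sum_eq_single_of_mem j hj]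
        · rw [W.inner_vec _ _ _ _ (hx j hj) (hzQ j) (hx j hj) (hzQ j),
            aux_inner_self, aux_inner_self]
          push_cast; rfl
        · intro i hi hne
          rw [W.inner_vec _ _ _ _ (hx j hj) (hzQ j) (hx i hi) (hzQ i),
            horth j hj i hi hne.symm, zero_mul]
      rw [aux_inner_self] at e1
      have e2 : ‖∑ j ∈ F, W.vec (x j) (z j)‖ ^ 2 = ∑ j ∈ F, ‖x j Ω‖ ^ 2 * ‖z j Ω‖ ^ 2 := by
        exact_mod_cast e1
      rw [e2, hZ, Finset.mul_sum]
      exact Finset.sum_le_sum fun j hj => mul_le_mul_of_nonneg_right (hxγ j hj) (sq_nonneg _)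
    have hZle : Z ≤ γ := by
      have e1 : ⟪∑ j ∈ F, W.vec (x j) (z j), W.ract t η⟫_ℂ = (Z : ℂ) := by
        rw [sum_inner, hZ, Complex.ofReal_sum]
        refine Finset.sum_congr rfl fun j hj => ?_
        rw [hio j hj _ (hzQ j) t htQ]
        change ⟪z j Ω, z j Ω⟫_ℂ = _
        rw [aux_inner_self]
      have e2 := norm_inner_le_norm (𝕜 := ℂ) (∑ j ∈ F, W.vec (x j) (z j)) (W.ract t η)
      rw [e1, Complex.norm_real, Real.norm_of_nonneg hZ0] at e2
      have e3 : Z ^ 2 ≤ γ * Z := by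
        calc Z ^ 2 ≤ (‖∑ j ∈ F, W.vec (x j) (z j)‖ * ‖W.ract t η‖) ^ 2 :=
              pow_le_pow_left₀ hZ0 e2 2
          _ = ‖∑ j ∈ F, W.vec (x j) (z j)‖ ^ 2 * ‖W.ract t η‖ ^ 2 := by ring
          _ ≤ (γ * Z) * 1 := mul_le_mul hsum hηt (sq_nonneg _) (by positivity)
          _ = γ * Z := by ring
      by_contra hlt
      push Not at hlt
      nlinarith
    -- Cauchy-Schwarz
    have hterm : ∀ j ∈ F, ‖⟪W.vec (x j) y, W.ract (d j) η⟫_ℂ‖ ≤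
        (‖y‖ * ‖z j Ω‖) * ‖(s * d j) Ω‖ := by
      intro j hj
      have hts : t * s = 1 := by
        have : s * (t * s) = s * 1 := by rw [← mul_assoc, hst, one_mul, mul_one]
        have hst2 : star t * s = 1 := by
          have := congrArg star hst
          rwa [star_mul, hsa.star_eq, star_one] at this
        have h3 := congrArg (fun u => star t * u) this
        simpa only [← mul_assoc, hst2, one_mul, mul_one] using h3
      have e1 : io j * d j = z j * (s * d j) := by
        simp only [z]
        rw [mul_assoc, ← mul_assoc t, hts, one_mul]
      rw [hio j hj y hy (d j) (hd j hj), e1, mul_apply_eq_comp (z j), ← aux_inner_star]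
      refine (norm_inner_le_norm _ _).trans (mul_le_mul_of_nonneg_right ?_ (norm_nonneg _))
      rw [← mul_apply_eq_comp]
      refine (aux_right_bound hTr (hQ (star_mem (hzQ j))) (hQ hy)).trans_eq ?_
      rw [aux_trace_norm hTr (hQ (hzQ j))]
    calc ‖∑ j ∈ F, ⟪W.vec (x j) y, W.ract (d j) η⟫_ℂ‖ ^ 2
        ≤ (∑ j ∈ F, (‖y‖ * ‖z j Ω‖) * ‖(s * d j) Ω‖) ^ 2 :=
          pow_le_pow_left₀ (norm_nonneg _) ((norm_sum_le _ _).trans (Finset.sum_le_sum hterm)) 2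
      _ ≤ (∑ j ∈ F, (‖y‖ * ‖z j Ω‖) ^ 2) * ∑ j ∈ F, ‖(s * d j) Ω‖ ^ 2 :=
          Finset.sum_mul_sq_le_sq_mul_sq _ _ _
      _ = (‖y‖ ^ 2 * Z) * ∑ j ∈ F, ‖(s * d j) Ω‖ ^ 2 := by
          simp only [mul_pow, ← Finset.mul_sum, hZ]
      _ ≤ (‖y‖ ^ 2 * γ) * ∑ j ∈ F, ‖(s * d j) Ω‖ ^ 2 := by gcongr
      _ = _ := by
          rw [Finset.mul_sum F _ ε, ← Finset.sum_add_distrib,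
            Finset.sum_congr rfl fun j hj => hsn (d j) (hd j hj)]
          ring
  -- let ε tend to zero
  have hlim : Tendsto (fun ε : ℝ =>
      γ * ‖y‖ ^ 2 * (∑ j ∈ F, ‖W.ract (d j) η‖ ^ 2 + ε * ∑ j ∈ F, ‖d j Ω‖ ^ 2))
      (nhdsWithin 0 (Set.Ioi 0)) (nhds (γ * ‖y‖ ^ 2 *
        (∑ j ∈ F, ‖W.ract (d j) η‖ ^ 2 + 0 * ∑ j ∈ F, ‖d j Ω‖ ^ 2))) := by
    refine (Continuous.tendsto ?_ 0).mono_left nhdsWithin_le_nhds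
    fun_prop
  rw [zero_mul, add_zero] at hlim
  exact ge_of_tendsto hlim (eventually_nhdsWithin_of_forall fun ε hε => main ε hε)

/-- Core inequality for arbitrary `η`. -/
theorem core_cyclic (hTr : IsTraceVector M Ω) (hQ : Q ≤ M) (η : W.K)
    {ι : Type*} (F : Finset ι) (x : ι → H →L[ℂ] H) (hx : ∀ j ∈ F, x j ∈ Q)
    (horth : ∀ i ∈ F, ∀ j ∈ F, i ≠ j → ⟪x i Ω, x j Ω⟫_ℂ = 0)
    (γ : ℝ) (hγ : 0 ≤ γ) (hxγ : ∀ j ∈ F, ‖x j Ω‖ ^ 2 ≤ γ)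
    (y : H →L[ℂ] H) (hy : y ∈ Q)
    (d : ι → H →L[ℂ] H) (hd : ∀ j ∈ F, d j ∈ Q) :
    ‖∑ j ∈ F, ⟪W.vec (x j) y, W.ract (d j) η⟫_ℂ‖ ^ 2 ≤
      γ * ‖y‖ ^ 2 * ∑ j ∈ F, ‖W.ract (d j) η‖ ^ 2 := by
  refine W.dense_span.induction (P := fun η => ‖∑ j ∈ F, ⟪W.vec (x j) y, W.ract (d j) η⟫_ℂ‖ ^ 2 ≤
      γ * ‖y‖ ^ 2 * ∑ j ∈ F, ‖W.ract (d j) η‖ ^ 2) ?_ ?_ η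
  · intro η hη
    obtain ⟨n, f, g, rfl⟩ := Submodule.mem_span_set'.1 hη
    choose a ha b hb hab using fun k => (g k).2
    have : ∑ k, f k • (g k : W.K) = ∑ k, W.vec (a k) (f k • b k) :=
      Finset.sum_congr rfl fun k _ => by rw [hab k, cb_smul W _ (ha k) (hb k)]
    rw [this]
    exact core_finite W hTr hQ a (fun k => f k • b k) ha (fun k => aux_smul_mem Q _ (hb k))
      F x hx horth γ hγ hxγ y hy d hd
  · refine isClosed_le ?_ ?_ <;> fun_prop

theorem cb_ract_add {b c : H →L[ℂ] H} (hb : b ∈ Q) (hc : c ∈ Q) (v : W.K) :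
    W.ract (b + c) v = W.ract b v + W.ract c v := by
  have : W.ract (b + c) = W.ract b + W.ract c := by
    refine cb_hom_ext W fun x hx y hy => cb_ext W fun x' hx' y' hy' => ?_
    rw [add_apply, inner_add_right, W.ract_vec _ _ _ (add_mem hb hc) hx hy,
      W.ract_vec _ _ _ hb hx hy, W.ract_vec _ _ _ hc hx hy,
      W.inner_vec _ _ _ _ hx' hy' hx (mul_mem hy (add_mem hb hc)),
      W.inner_vec _ _ _ _ hx' hy' hx (mul_mem hy hb),
      W.inner_vec _ _ _ _ hx' hy' hx (mul_mem hy hc), mul_add y, add_apply, inner_add_right,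
      mul_add]
  rw [this]; rfl

theorem cb_ract_smul {b : H →L[ℂ] H} (c : ℂ) (hb : b ∈ Q) (v : W.K) :
    W.ract (c • b) v = c • W.ract b v := by
  have : W.ract (c • b) = c • W.ract b := by
    refine cb_hom_ext W fun x hx y hy => ?_
    rw [smul_apply, W.ract_vec _ _ _ (aux_smul_mem Q c hb) hx hy, W.ract_vec _ _ _ hb hx hy,
      cb_smul W c hx (mul_mem hy hb), mul_smul_comm]
  rw [this]; rfl

/-- The closed right `Q`-module generated by finitely many vectors. -/
def rmod {n : ℕ} (ζ : Fin n → W.K) : Submodule ℂ W.K :=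
  (Submodule.span ℂ {v | ∃ k, ∃ b ∈ Q, v = W.ract b (ζ k)}).topologicalClosure

theorem rmod_induction {n : ℕ} {ζ : Fin n → W.K}
    (S : W.K →L[ℂ] W.K) (V : Submodule ℂ W.K) (hV : IsClosed (V : Set W.K))
    (h : ∀ k, ∀ b ∈ Q, S (W.ract b (ζ k)) ∈ V) {v : W.K} (hv : v ∈ rmod W ζ) : S v ∈ V := by
  have h1 : rmod W ζ ≤ V.comap S.toLinearMap := by
    refine Submodule.topologicalClosure_minimal _ ?_ (hV.preimage S.continuous)
    refine Submodule.span_le.2 ?_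
    rintro _ ⟨k, b, hb, rfl⟩
    exact h k b hb
  exact h1 hv

theorem rmod_closed {n : ℕ} (ζ : Fin n → W.K) : IsClosed (rmod W ζ : Set W.K) :=
  Submodule.isClosed_topologicalClosure _

theorem rmod_gen {n : ℕ} (ζ : Fin n → W.K) (k : Fin n) {b : H →L[ℂ] H} (hb : b ∈ Q) :
    W.ract b (ζ k) ∈ rmod W ζ :=
  Submodule.le_topologicalClosure _ (Submodule.subset_span ⟨k, b, hb, rfl⟩)

theorem rmod_ract {n : ℕ} (ζ : Fin n → W.K) {b : H →L[ℂ] H} (hb : b ∈ Q) {v : W.K}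
    (hv : v ∈ rmod W ζ) : W.ract b v ∈ rmod W ζ := by
  refine rmod_induction W (W.ract b) _ (rmod_closed W ζ) ?_ hv
  intro k c hc
  rw [cb_ract_mul W hb hc]
  exact rmod_gen W ζ k (mul_mem hc hb)

theorem core_module (hTr : IsTraceVector M Ω) (hQ : Q ≤ M)
    {ι : Type*} (F : Finset ι) (x : ι → H →L[ℂ] H) (hx : ∀ j ∈ F, x j ∈ Q)
    (horth : ∀ i ∈ F, ∀ j ∈ F, i ≠ j → ⟪x i Ω, x j Ω⟫_ℂ = 0)
    (γ : ℝ) (hγ : 0 ≤ γ) (hxγ : ∀ j ∈ F, ‖x j Ω‖ ^ 2 ≤ γ)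
    (y : H →L[ℂ] H) (hy : y ∈ Q) (n : ℕ) :
    ∀ (ζ : Fin n → W.K) (ξ : ι → W.K), (∀ j ∈ F, ξ j ∈ rmod W ζ) →
    ‖∑ j ∈ F, ⟪W.vec (x j) y, ξ j⟫_ℂ‖ ≤
      n * (Real.sqrt (γ * ‖y‖ ^ 2) * Real.sqrt (∑ j ∈ F, ‖ξ j‖ ^ 2)) := by
  classical
  induction n with
  | zero =>
    intro ζ ξ hξ
    have h0 : ∀ j ∈ F, ξ j = 0 := by
      intro j hj
      have := rmod_induction W (ContinuousLinearMap.id ℂ W.K) ⊥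
        (by simp) (fun k => k.elim0) (hξ j hj)
      simpa using this
    rw [Finset.sum_eq_zero fun j hj => by rw [h0 j hj, inner_zero_right]]
    simp
  | succ n ih =>
    intro ζ ξ hξ
    let ζ' : Fin n → W.K := fun k => ζ k.castSucc
    let V := rmod W ζ'
    have hVc : IsClosed (V : Set W.K) := rmod_closed W ζ'
    have : CompleteSpace V := hVc.completeSpace_coe
    let e := V.starProjection
    have heV : ∀ v, e v ∈ V := fun v => Submodule.starProjection_apply_mem V v
    have heo : ∀ v, v - e v ∈ Vᗮ := fun v => Submodule.sub_starProjection_mem_orthogonal v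
    let η : W.K := ζ (Fin.last n) - e (ζ (Fin.last n))
    let V' := rmod W (fun _ : Fin 1 => η)
    have hVo : ∀ b ∈ Q, ∀ v ∈ Vᗮ, W.ract b v ∈ Vᗮ := by
      intro b hb v hv
      rw [Submodule.mem_orthogonal'] at hv ⊢
      intro u hu
      rw [cb_ract_adj W hTr hQ hb]
      exact hv _ (rmod_ract W ζ' (star_mem hb) hu)
    have he1 : ∀ v ∈ V, v - e v = 0 := by
      intro v hv
      rw [sub_eq_zero]
      exact (Submodule.starProjection_eq_self_iff.2 hv).symm
    have hcomp : ∀ v ∈ rmod W ζ, v - e v ∈ V' := by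
      intro v hv
      refine rmod_induction W (ContinuousLinearMap.id ℂ W.K - e) V'
        (rmod_closed W _) ?_ hv
      intro k b hb
      change W.ract b (ζ k) - e (W.ract b (ζ k)) ∈ V'
      induction k using Fin.lastCases with
      | cast k =>
        rw [he1 _ (rmod_gen W ζ' k hb)]
        exact zero_mem _
      | last =>
        have e1 : W.ract b (ζ (Fin.last n)) =
            W.ract b (e (ζ (Fin.last n))) + W.ract b η := by
          rw [← map_add]; congr 1; simp only [η]; abel
        have e2 : e (W.ract b η) = 0 :=
          (Submodule.starProjection_apply_eq_zero_iff V).2 (hVo b hb _ (heo _))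
        have e3 := he1 _ (rmod_ract W ζ' hb (heV (ζ (Fin.last n))))
        rw [e1, map_add, e2, add_zero, add_sub_right_comm, e3, zero_add]
        exact rmod_gen W (fun _ : Fin 1 => η) 0 hb
    -- the cyclic part
    have hcyc : ∀ ξ : ι → W.K, (∀ j ∈ F, ξ j ∈ V') →
        ‖∑ j ∈ F, ⟪W.vec (x j) y, ξ j⟫_ℂ‖ ≤
        Real.sqrt (γ * ‖y‖ ^ 2) * Real.sqrt (∑ j ∈ F, ‖ξ j‖ ^ 2) := by
      intro ξ hξ
      let C : Set W.K := {v | ∃ b ∈ Q, v = W.ract b η}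
      have hC : ∀ v ∈ V', v ∈ closure C := by
        intro v hv
        have hle : (Submodule.span ℂ {v | ∃ _ : Fin 1, ∃ b ∈ Q, v = W.ract b η} : Set W.K) ⊆ C := by
          intro u hu
          induction hu using Submodule.span_induction with
          | mem u hu =>
            obtain ⟨_, b, hb, rfl⟩ := hu
            exact ⟨b, hb, rfl⟩
          | zero =>
            refine ⟨(0 : ℂ) • 1, aux_smul_mem Q _ (one_mem Q), ?_⟩
            rw [cb_ract_smul W _ (one_mem Q), zero_smul]
          | add u w _ _ hu hw =>
            obtain ⟨b, hb, rfl⟩ := hu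
            obtain ⟨c, hc, rfl⟩ := hw
            exact ⟨b + c, add_mem hb hc, (cb_ract_add W hb hc η).symm⟩
          | smul c u _ hu =>
            obtain ⟨b, hb, rfl⟩ := hu
            exact ⟨c • b, aux_smul_mem Q c hb, (cb_ract_smul W c hb η).symm⟩
        have hv' : v ∈ closure
            (Submodule.span ℂ {v | ∃ _ : Fin 1, ∃ b ∈ Q, v = W.ract b η} : Set W.K) := by
          rw [← Submodule.topologicalClosure_coe]; exact hv
        exact closure_mono hle hv'
      have hmem : ξ ∈ closure (Set.pi (F : Set ι) fun _ => C) := by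
        rw [closure_pi_set]
        exact fun j hj => hC _ (hξ j hj)
      refine closure_minimal (t := {ξ : ι → W.K | ‖∑ j ∈ F, ⟪W.vec (x j) y, ξ j⟫_ℂ‖ ≤
        Real.sqrt (γ * ‖y‖ ^ 2) * Real.sqrt (∑ j ∈ F, ‖ξ j‖ ^ 2)}) ?_ ?_ hmem
      · intro ξ hξ
        choose! d hd hdd using hξ
        have := core_cyclic W hTr hQ η F x hx horth γ hγ hxγ y hy d fun j hj => hd j hj
        change ‖_‖ ≤ _
        rw [Finset.sum_congr rfl fun j hj => by rw [hdd j hj],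
          Finset.sum_congr (s₁ := F) (f := fun j => ‖ξ j‖ ^ 2) rfl fun j hj => by rw [hdd j hj],
          ← Real.sqrt_mul (by positivity)]
        exact Real.le_sqrt_of_sq_le this
      · refine isClosed_le ?_ ?_ <;> fun_prop
    have hnorm : ∀ v : W.K, ‖e v‖ ^ 2 + ‖v - e v‖ ^ 2 = ‖v‖ ^ 2 := by
      intro v
      have := norm_add_sq_eq_norm_sq_add_norm_sq_of_inner_eq_zero _ _
        (Submodule.inner_right_of_mem_orthogonal (heV v) (heo v))
      rw [add_sub_cancel] at this
      nlinarith
    have h1 := ih ζ' (fun j => e (ξ j)) fun j _ => heV _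
    have h2 := hcyc (fun j => ξ j - e (ξ j)) fun j hj => hcomp _ (hξ j hj)
    have h1' : Real.sqrt (∑ j ∈ F, ‖e (ξ j)‖ ^ 2) ≤ Real.sqrt (∑ j ∈ F, ‖ξ j‖ ^ 2) :=
      Real.sqrt_le_sqrt (Finset.sum_le_sum fun j _ => by
        nlinarith [hnorm (ξ j), sq_nonneg ‖ξ j - e (ξ j)‖])
    have h2' : Real.sqrt (∑ j ∈ F, ‖ξ j - e (ξ j)‖ ^ 2) ≤ Real.sqrt (∑ j ∈ F, ‖ξ j‖ ^ 2) :=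
      Real.sqrt_le_sqrt (Finset.sum_le_sum fun j _ => by
        nlinarith [hnorm (ξ j), sq_nonneg ‖e (ξ j)‖])
    have hs : ∑ j ∈ F, ⟪W.vec (x j) y, ξ j⟫_ℂ = ∑ j ∈ F, ⟪W.vec (x j) y, e (ξ j)⟫_ℂ +
        ∑ j ∈ F, ⟪W.vec (x j) y, ξ j - e (ξ j)⟫_ℂ := by
      rw [← Finset.sum_add_distrib]
      refine Finset.sum_congr rfl fun j _ => ?_
      rw [← inner_add_right, add_sub_cancel]
    rw [hs]
    refine (norm_add_le _ _).trans ((add_le_add h1 h2).trans ?_)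
    push_cast
    rw [add_mul, one_mul]
    gcongr

end Core

section Final

variable {M Q : VonNeumannAlgebra H} {Ω : H} (W : CoarseBimodule M Ω (Q : Set (H →L[ℂ] H)))

/-- Splitting of an elementary tensor along a finite family of operators. -/
theorem cb_vec_split (F : Finset (H →L[ℂ] H)) (hF : ∀ p ∈ F, p ∈ Q) {x y : H →L[ℂ] H}
    (hx : x ∈ Q) (hy : y ∈ Q) :
    W.vec x y = ∑ p ∈ F, W.vec (p * x) y + W.vec ((1 - ∑ p ∈ F, p) * x) y := by
  have hr : (1 - ∑ p ∈ F, p) * x ∈ Q :=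
    mul_mem (sub_mem (one_mem Q) (sum_mem hF)) hx
  refine cb_ext W fun a ha b hb => ?_
  rw [inner_add_right, inner_sum, W.inner_vec _ _ _ _ ha hb hx hy,
    W.inner_vec _ _ _ _ ha hb hr hy,
    Finset.sum_congr rfl fun p hp => W.inner_vec _ _ _ _ ha hb (mul_mem (hF p hp) hx) hy,
    ← Finset.sum_mul, ← add_mul, ← inner_sum, ← inner_add_right]
  congr 2
  rw [sub_mul, one_mul, Finset.sum_mul, sub_apply, sum_apply, add_sub_cancel]

/-- Bessel inequality for a finite orthogonal family of projections. -/
theorem cb_bessel (F : Finset (H →L[ℂ] H)) (hF : ∀ p ∈ F, p ∈ Q ∧ IsProj p)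
    (ho : ∀ p ∈ F, ∀ q ∈ F, p ≠ q → p * q = 0) (η : W.K) :
    ∑ p ∈ F, ‖W.lact p η‖ ^ 2 ≤ ‖η‖ ^ 2 := by
  have key : ∀ p ∈ F, ∀ q ∈ F, ⟪W.lact p η, W.lact q η⟫_ℂ = ⟪η, W.lact (p * q) η⟫_ℂ := by
    intro p hp q hq
    rw [cb_lact_adj W (hF p hp).1, (hF p hp).2.2.star_eq, cb_lact_mul W (hF p hp).1 (hF q hq).1]
  have hpp : ∀ p ∈ F, ⟪η, W.lact p η⟫_ℂ = ((‖W.lact p η‖ ^ 2 : ℝ) : ℂ) := by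
    intro p hp
    rw [← aux_inner_self, key p hp p hp, ← (hF p hp).2.1]
  set S : ℝ := ∑ p ∈ F, ‖W.lact p η‖ ^ 2 with hS
  have hS0 : 0 ≤ S := Finset.sum_nonneg fun _ _ => sq_nonneg _
  have h1 : ⟪η, ∑ p ∈ F, W.lact p η⟫_ℂ = (S : ℂ) := by
    rw [inner_sum, hS, Complex.ofReal_sum]
    exact Finset.sum_congr rfl hpp
  have h2 : ‖∑ p ∈ F, W.lact p η‖ ^ 2 = S := by
    have : ⟪∑ p ∈ F, W.lact p η, ∑ p ∈ F, W.lact p η⟫_ℂ = (S : ℂ) := by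
      rw [sum_inner, hS, Complex.ofReal_sum]
      refine Finset.sum_congr rfl fun p hp => ?_
      rw [inner_sum, Finset.sum_eq_single_of_mem p hp]
      · exact aux_inner_self _
      · intro q hq hne
        rw [key p hp q hq, ho p hp q hq hne.symm, cb_lact_zero, inner_zero_right]
    rw [aux_inner_self] at this
    exact_mod_cast this
  have h3 := norm_inner_le_norm (𝕜 := ℂ) η (∑ p ∈ F, W.lact p η)
  rw [h1, Complex.norm_real, Real.norm_of_nonneg hS0] at h3
  have h4 : S ^ 2 ≤ ‖η‖ ^ 2 * S := by
    calc S ^ 2 ≤ (‖η‖ * ‖∑ p ∈ F, W.lact p η‖) ^ 2 := pow_le_pow_left₀ hS0 h3 2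
      _ = ‖η‖ ^ 2 * S := by rw [mul_pow, h2]
  by_contra hlt
  push Not at hlt
  nlinarith [sq_nonneg ‖η‖]

/-- A vector of the coarse bimodule whose orbit under a diffuse algebra lies in a finitely
generated right module vanishes. -/
theorem coarse_vanish (hTr : IsTraceVector M Ω) (hQ : Q ≤ M) {A : VonNeumannAlgebra H}
    (hAQ : A ≤ Q) (hA : DiffuseSet (A : Set (H →L[ℂ] H))) {n : ℕ} (ζ : Fin n → W.K) (η : W.K)
    (h : ∀ a ∈ A, W.lact a η ∈ rmod W ζ) : η = 0 := by
  classical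
  refine cb_ext W fun x hx y hy => ?_
  rw [inner_zero_right]
  have main : ∀ t : ℝ, 0 < t → ‖⟪W.vec x y, η⟫_ℂ‖ ≤
      n * (Real.sqrt ((‖x‖ ^ 2 * t) * ‖y‖ ^ 2) * Real.sqrt (‖η‖ ^ 2)) +
        (‖x‖ * t * ‖y Ω‖) * ‖η‖ := by
    intro t ht
    obtain ⟨F, hF, ho, hr⟩ := aux_partition (Ω := Ω) hA t t ht ht
    have hFQ : ∀ p ∈ F, p ∈ Q := fun p hp => hAQ (hF p hp).1
    rw [cb_vec_split W F hFQ hx hy, inner_add_left, sum_inner]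
    refine (norm_add_le _ _).trans (add_le_add ?_ ?_)
    · have e : ∀ p ∈ F, ⟪W.vec (p * x) y, η⟫_ℂ = ⟪W.vec (p * x) y, W.lact p η⟫_ℂ := by
        intro p hp
        have h1 := cb_lact_adj W (hFQ p hp) (W.vec (p * x) y) η
        rw [(hF p hp).2.1.2.star_eq, W.lact_vec _ _ _ (hFQ p hp) (mul_mem (hFQ p hp) hx) hy,
          ← mul_assoc, ← (hF p hp).2.1.1] at h1
        exact h1
      rw [Finset.sum_congr rfl e]
      refine (core_module W hTr hQ F (fun p => p * x) (fun p hp => mul_mem (hFQ p hp) hx) ?_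
        (‖x‖ ^ 2 * t) (by positivity) ?_ y hy n ζ (fun p => W.lact p η)
        (fun p hp => h p (hF p hp).1)).trans ?_
      · intro p hp q hq hne
        simp only [mul_apply_eq_comp]
        rw [← aux_inner_star', (hF p hp).2.1.2.star_eq, ← mul_apply_eq_comp p q, ho p hp q hq hne]
        simp
      · intro p hp
        have := aux_right_bound hTr (hQ (hFQ p hp)) (hQ hx)
        calc ‖(p * x) Ω‖ ^ 2 ≤ (‖x‖ * ‖p Ω‖) ^ 2 := pow_le_pow_left₀ (norm_nonneg _) this 2
          _ = ‖x‖ ^ 2 * ‖p Ω‖ ^ 2 := by ring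
          _ ≤ ‖x‖ ^ 2 * t := by gcongr; exact (hF p hp).2.2
      · have hb := cb_bessel W F (fun p hp => ⟨hFQ p hp, (hF p hp).2.1⟩) ho η
        have := Real.sqrt_le_sqrt hb
        gcongr
    · have hs : (1 - ∑ p ∈ F, p) ∈ Q := sub_mem (one_mem Q) (sum_mem hFQ)
      refine (norm_inner_le_norm _ _).trans (mul_le_mul_of_nonneg_right ?_ (norm_nonneg _))
      rw [cb_norm W (mul_mem hs hx) hy]
      refine mul_le_mul_of_nonneg_right ?_ (norm_nonneg _)
      refine (aux_right_bound hTr (hQ hs) (hQ hx)).trans ?_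
      rw [sub_apply, sum_apply, one_apply_eq_self]
      gcongr
  have hlim : Tendsto (fun t : ℝ =>
      n * (Real.sqrt ((‖x‖ ^ 2 * t) * ‖y‖ ^ 2) * Real.sqrt (‖η‖ ^ 2)) +
        (‖x‖ * t * ‖y Ω‖) * ‖η‖) (nhdsWithin 0 (Set.Ioi 0)) (nhds (
      n * (Real.sqrt ((‖x‖ ^ 2 * 0) * ‖y‖ ^ 2) * Real.sqrt (‖η‖ ^ 2)) +
        (‖x‖ * 0 * ‖y Ω‖) * ‖η‖)) := by
    refine (Continuous.tendsto ?_ 0).mono_left nhdsWithin_le_nhds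
    fun_prop
  have := ge_of_tendsto hlim (eventually_nhdsWithin_of_forall fun t ht => main t ht)
  simp only [mul_zero, zero_mul, Real.sqrt_zero, add_zero] at this
  exact norm_le_zero_iff.1 this

end Final

end Proof12

/-- for a diffuse subalgebra `Q` of a tracial von Neumann algebra `M`,
the weak intertwining space `wI_M(Q, Q)` is contained in the anti-coarse space
`H_antic(Q ≤ M)`. -/
theorem statement12 (M : VonNeumannAlgebra H) (Ω : H) (hTr : IsTraceVector M Ω)
    (Q : VonNeumannAlgebra H) (hQ : Q ≤ M) (hdiff : DiffuseSet (Q : Set (H →L[ℂ] H))) :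
    wIntertwiners M Ω (Q : Set (H →L[ℂ] H)) (Q : Set (H →L[ℂ] H)) ⊆
      antiCoarse M Ω (Q : Set (H →L[ℂ] H)) := by
  rintro ξ ⟨-, A, -, -, hAQ, hA, n, ζ, hsub⟩ W T hTl hTr'
  have hc : corner 1 (A : Set (H →L[ℂ] H)) = A := by
    simp [corner]
  rw [hc] at hAQ hA hsub
  refine coarse_vanish W hTr hQ (A := A) (fun a ha => hAQ ha) hA (fun k => T (ζ k)) (T ξ) ?_
  intro a ha
  rw [← hTl a (hAQ ha)]
  have hmem : a ξ ∈ (Submodule.span ℂ {η : H | ∃ j : Fin n, ∃ b ∈ (Q : Set (H →L[ℂ] H)),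
      ∃ R : H →L[ℂ] H, IsRightMul M Ω b R ∧ η = R (ζ j)}).topologicalClosure := by
    refine hsub ⟨a, ha, 1, one_mem Q, 1, ⟨?_, rfl⟩, rfl⟩
    intro m _
    rw [mul_one, one_mul]
  have hle : (Submodule.span ℂ {η : H | ∃ j : Fin n, ∃ b ∈ (Q : Set (H →L[ℂ] H)),
      ∃ R : H →L[ℂ] H, IsRightMul M Ω b R ∧ η = R (ζ j)}).topologicalClosure ≤
      (rmod W fun k => T (ζ k)).comap T.toLinearMap := by
    refine Submodule.topologicalClosure_minimal _ ?_ ((rmod_closed W _).preimage T.continuous)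
    refine Submodule.span_le.2 ?_
    rintro _ ⟨k, b, hb, R, hR, rfl⟩
    change T (R (ζ k)) ∈ rmod W _
    rw [hTr' b hb R hR]
    exact rmod_gen W (fun k => T (ζ k)) k hb
  exact hle hmem

end
end

section
/- Let (M,τ) be a tracial von Neumann algebra and N ≤ M a diffuse von Neumann subalgebra. Then the very weak quasi-normalizer N^{vwq}_M(N) is contained in the anti-coarse space H_antic(N ≤ M). -/
/-! # Common framework: tracial von Neumann algebras in standard form,
amenability, free group factors, 1-bounded entropy, bimodules. -/

noncomputable section

open scoped InnerProductSpace
open Filter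

universe u

variable {H : Type u} [NormedAddCommGroup H] [InnerProductSpace ℂ H] [CompleteSpace H]

/-! ## Proof of the theorem -/

/-- Right multiplication by a unitary of `M` preserves the inner products of `M Ω`. -/
theorem aux_inner_right (M : VonNeumannAlgebra H) (Ω : H) (hTr : IsTraceVector M Ω)
    (a b c : H →L[ℂ] H) (ha : a ∈ M) (hb : b ∈ M) (hc : c ∈ M) (haa : a * star a = 1) :
    ⟪(b * a) Ω, (c * a) Ω⟫_ℂ = ⟪b Ω, c Ω⟫_ℂ := by
  have key : ∀ x y : H →L[ℂ] H, ⟪x Ω, y Ω⟫_ℂ = ⟪(star y * x) Ω, Ω⟫_ℂ := by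
    intro x y
    rw [ContinuousLinearMap.star_eq_adjoint, ContinuousLinearMap.mul_apply,
      ContinuousLinearMap.adjoint_inner_left]
  rw [key, key, star_mul, mul_assoc,
    hTr.tracial (star a) (star c * (b * a)) (star_mem ha)
      (mul_mem (star_mem hc) (mul_mem hb ha))]
  congr 2
  rw [mul_assoc, mul_assoc, haa, mul_one]

/-- Existence of the right multiplication operator by a unitary of `M`. -/
theorem aux_rightMul (M : VonNeumannAlgebra H) (Ω : H) (hTr : IsTraceVector M Ω)
    (a : H →L[ℂ] H) (ha : a ∈ M) (haa : a * star a = 1) :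
    ∃ R : H →L[ℂ] H, IsRightMul M Ω a R ∧ ∀ x ∈ M, R (x Ω) = (x * a) Ω := by
  let S : Submodule ℂ (H →L[ℂ] H) := Subalgebra.toSubmodule M.toStarSubalgebra.toSubalgebra
  let e : S →ₗ[ℂ] H :=
    { toFun := fun x => (x : H →L[ℂ] H) Ω
      map_add' := fun x y => rfl
      map_smul' := fun c x => rfl }
  let f : S →ₗ[ℂ] H :=
    { toFun := fun x => (x : H →L[ℂ] H) (a Ω)
      map_add' := fun x y => rfl
      map_smul' := fun c x => rfl }
  have hd : DenseRange e := by
    refine hTr.cyclic.mono ?_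
    rintro _ ⟨x, hx, rfl⟩
    exact ⟨⟨x, hx⟩, rfl⟩
  have hn : ∃ C, ∀ x, ‖f x‖ ≤ C * ‖e x‖ := by
    refine ⟨1, fun x => ?_⟩
    have h := aux_inner_right M Ω hTr a x x ha x.2 x.2 haa
    rw [inner_self_eq_norm_sq_to_K, inner_self_eq_norm_sq_to_K] at h
    have h2 : ‖((x : H →L[ℂ] H) * a) Ω‖ ^ 2 = ‖(x : H →L[ℂ] H) Ω‖ ^ 2 := by
      exact_mod_cast h
    have h3 := (sq_eq_sq₀ (norm_nonneg _) (norm_nonneg _)).1 h2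
    rw [one_mul]
    exact h3.le
  have hR : ∀ x ∈ M, f.extendOfNorm e (x Ω) = (x * a) Ω := fun x hx =>
    LinearMap.extendOfNorm_eq hd hn ⟨x, hx⟩
  refine ⟨f.extendOfNorm e, ⟨?_, ?_⟩, hR⟩
  · intro m hm
    refine ContinuousLinearMap.ext_on (s := (fun a : H →L[ℂ] H => a Ω) '' (M : Set (H →L[ℂ] H)))
      (hTr.cyclic.mono Submodule.subset_span) ?_
    rintro _ ⟨x, hx, rfl⟩
    have h1 := hR x hx
    have h2 := hR (m * x) (mul_mem hm hx)
    change m (f.extendOfNorm e (x Ω)) = f.extendOfNorm e ((m * x) Ω)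
    rw [h1, h2]
    rfl
  · have := hR 1 (one_mem M)
    simpa using this

/-- An operator preserving inner products on a total set preserves norms. -/
theorem aux_isometry {K : Type*} [NormedAddCommGroup K] [InnerProductSpace ℂ K]
    [CompleteSpace K] (S : Set K) (hS : Dense (Submodule.span ℂ S : Set K)) (A : K →L[ℂ] K)
    (hA : ∀ x ∈ S, ∀ y ∈ S, ⟪A x, A y⟫_ℂ = ⟪x, y⟫_ℂ) (x : K) : ‖A x‖ = ‖x‖ := by
  refine (A.norm_map_iff_adjoint_comp_self).2 ?_ x
  refine ContinuousLinearMap.ext_on hS ?_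
  intro x hx
  have h : innerSL ℂ ((ContinuousLinearMap.adjoint A ∘L A) x) = innerSL ℂ x := by
    refine ContinuousLinearMap.ext_on hS ?_
    intro y hy
    simp only [innerSL_apply_apply, ContinuousLinearMap.comp_apply,
      ContinuousLinearMap.adjoint_inner_left]
    exact hA x hx y hy
  refine ext_inner_right ℂ fun y => ?_
  simpa using congrArg (fun g => g y) h

/-- Uniformly Lipschitz, additive and homogeneous functionals that tend to zero pointwise on a
total set tend to zero pointwise. -/
theorem aux_tendsto {K : Type*} [NormedAddCommGroup K] [InnerProductSpace ℂ K]
    (S : Set K) (hS : Dense (Submodule.span ℂ S : Set K)) (f : ℕ → K → ℂ) (C : ℝ)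
    (hadd : ∀ n x y, f n (x + y) = f n x + f n y)
    (hsmul : ∀ n (c : ℂ) x, ‖f n (c • x)‖ = ‖c‖ * ‖f n x‖)
    (hb : ∀ n x, ‖f n x‖ ≤ C * ‖x‖)
    (h : ∀ x ∈ S, Tendsto (fun n => f n x) atTop (nhds 0)) (x : K) :
    Tendsto (fun n => f n x) atTop (nhds 0) := by
  have hspan : ∀ x ∈ Submodule.span ℂ S, Tendsto (fun n => f n x) atTop (nhds 0) := by
    intro x hx
    induction hx using Submodule.span_induction with
    | mem x hx => exact h x hx
    | zero =>
      have : ∀ n, f n 0 = 0 := fun n => by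
        have := hb n 0
        rw [norm_zero, mul_zero] at this
        exact norm_le_zero_iff.1 this
      simp [this]
    | add x y _ _ hx hy =>
      simpa [hadd] using hx.add hy
    | smul c x _ hx =>
      rw [tendsto_zero_iff_norm_tendsto_zero] at hx ⊢
      simpa [hsmul] using hx.const_mul ‖c‖
  rw [Metric.tendsto_atTop]
  intro ε hε
  have hC : 0 < |C| + 1 := by positivity
  obtain ⟨y, hy, hxy⟩ := Metric.mem_closure_iff.1 (hS x) (ε / 2 / (|C| + 1)) (by positivity)
  obtain ⟨n₀, hn₀⟩ := (Metric.tendsto_atTop.1 (hspan y hy)) (ε / 2) (by positivity)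
  refine ⟨n₀, fun n hn => ?_⟩
  have h1 := hn₀ n hn
  rw [dist_zero_right] at h1 ⊢
  have h2 : f n x = f n (x - y) + f n y := by rw [← hadd, sub_add_cancel]
  have h3 : ‖f n (x - y)‖ ≤ (|C| + 1) * ‖x - y‖ :=
    (hb n _).trans (mul_le_mul_of_nonneg_right (by linarith [le_abs_self C]) (norm_nonneg _))
  rw [dist_eq_norm, lt_div_iff₀ hC] at hxy
  rw [h2]
  have := norm_add_le (f n (x - y)) (f n y)
  linarith

/-- Mixing for sequences of norm preserving operators, checked on a total set. -/
theorem aux_mixing {K : Type*} [NormedAddCommGroup K] [InnerProductSpace ℂ K]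
    (S : Set K) (hS : Dense (Submodule.span ℂ S : Set K)) (A B : ℕ → K →L[ℂ] K)
    (hA : ∀ n x, ‖A n x‖ = ‖x‖) (hB : ∀ n x, ‖B n x‖ = ‖x‖)
    (h : ∀ x ∈ S, ∀ y ∈ S, Tendsto (fun n => ⟪A n x, B n y⟫_ℂ) atTop (nhds 0)) (x y : K) :
    Tendsto (fun n => ⟪A n x, B n y⟫_ℂ) atTop (nhds 0) := by
  have h1 : ∀ x ∈ S, ∀ y, Tendsto (fun n => ⟪A n x, B n y⟫_ℂ) atTop (nhds 0) := by
    intro x hx y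
    refine aux_tendsto S hS (fun n y => ⟪A n x, B n y⟫_ℂ) ‖x‖ ?_ ?_ ?_ (h x hx) y
    · intro n y z; simp [inner_add_right]
    · intro n c y; simp [inner_smul_right]
    · intro n y
      have := norm_inner_le_norm (𝕜 := ℂ) (A n x) (B n y)
      rwa [hA, hB] at this
  refine aux_tendsto S hS (fun n x => ⟪A n x, B n y⟫_ℂ) ‖y‖ ?_ ?_ ?_ (fun x hx => h1 x hx y) x
  · intro n y z; simp [inner_add_left]
  · intro n c y; simp [mul_comm]
  · intro n x
    have := norm_inner_le_norm (𝕜 := ℂ) (A n x) (B n y)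
    rwa [hA, hB, mul_comm] at this

/-- for a diffuse subalgebra `N` of a tracial von Neumann algebra `M`,
the very weak quasi-normalizer `N^{vwq}_M(N)` is contained in the anti-coarse space
`H_antic(N ≤ M)` (operators being regarded inside `L²(M)` via `u ↦ u Ω`). -/
theorem statement13 (M : VonNeumannAlgebra H) (Ω : H) (hTr : IsTraceVector M Ω)
    (N : VonNeumannAlgebra H) (hN : N ≤ M) (hdiff : DiffuseSet (N : Set (H →L[ℂ] H))) :
    (fun u : H →L[ℂ] H => u Ω) '' vwqNormalizer M (N : Set (H →L[ℂ] H)) ⊆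
      antiCoarse M Ω (N : Set (H →L[ℂ] H)) := by
  rintro _ ⟨u, ⟨⟨huM, hu1, hu2⟩, v, ⟨hvM, hv1, hv2⟩, w, hw, hw0⟩, rfl⟩
  intro W T hTl hTr'
  have hwM : ∀ n, unitaryIn M (w n) := fun n => (hw n).1
  have hwN : ∀ n, w n ∈ N := fun n => (hw n).2.2
  have hex : ∀ n, ∃ a ∈ N, w n = u * a * v := fun n => (hw n).2.1
  choose a haN hwa using hex
  have haM : ∀ n, a n ∈ M := fun n => hN (haN n)
  have ha : ∀ n, a n = star u * w n * star v := by
    intro n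
    calc a n = (star u * u) * a n * (v * star v) := by rw [hu1, hv2, one_mul, mul_one]
      _ = star u * (u * a n * v) * star v := by simp only [mul_assoc]
      _ = _ := by rw [← hwa n]
  have haa : ∀ n, a n * star (a n) = 1 := by
    intro n
    calc a n * star (a n) = star u * (w n * ((star v * v) * star (w n))) * u := by
          rw [ha n]; simp only [star_mul, star_star, mul_assoc]
      _ = 1 := by rw [hv1, one_mul, (hwM n).2.2, mul_one, hu1]
  have huaw : ∀ n, u * a n = w n * star v := by
    intro n
    rw [hwa n, mul_assoc, hv2, mul_one]
  -- the total set of elementary tensors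
  let S : Set W.K := {x | ∃ a ∈ (N : Set (H →L[ℂ] H)), ∃ b ∈ (N : Set (H →L[ℂ] H)), x = W.vec a b}
  have hS : Dense (Submodule.span ℂ S : Set W.K) := W.dense_span
  have hA : ∀ n x, ‖W.lact (w n) x‖ = ‖x‖ := by
    intro n
    refine aux_isometry S hS _ ?_
    rintro _ ⟨b, hb, c, hc, rfl⟩ _ ⟨b', hb', c', hc', rfl⟩
    rw [W.lact_vec _ _ _ (hwN n) hb hc, W.lact_vec _ _ _ (hwN n) hb' hc',
      W.inner_vec _ _ _ _ (mul_mem (hwN n) hb) hc (mul_mem (hwN n) hb') hc',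
      W.inner_vec _ _ _ _ hb hc hb' hc']
    congr 1
    rw [ContinuousLinearMap.mul_apply, ContinuousLinearMap.mul_apply,
      ← ContinuousLinearMap.adjoint_inner_left, ← ContinuousLinearMap.star_eq_adjoint,
      ← ContinuousLinearMap.mul_apply, (hwM n).2.1, ContinuousLinearMap.one_apply]
  have hB : ∀ n x, ‖W.ract (a n) x‖ = ‖x‖ := by
    intro n
    refine aux_isometry S hS _ ?_
    rintro _ ⟨b, hb, c, hc, rfl⟩ _ ⟨b', hb', c', hc', rfl⟩
    rw [W.ract_vec _ _ _ (haN n) hb hc, W.ract_vec _ _ _ (haN n) hb' hc',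
      W.inner_vec _ _ _ _ hb (mul_mem hc (haN n)) hb' (mul_mem hc' (haN n)),
      W.inner_vec _ _ _ _ hb hc hb' hc',
      aux_inner_right M Ω hTr (a n) c c' (haM n) (hN hc) (hN hc') (haa n)]
  have hmix := aux_mixing S hS (fun n => W.lact (w n)) (fun n => W.ract (a n)) hA hB (by
    rintro _ ⟨b, hb, c, hc, rfl⟩ _ ⟨b', hb', c', hc', rfl⟩
    have heq : ∀ n, ⟪W.lact (w n) (W.vec b c), W.ract (a n) (W.vec b' c')⟫_ℂ =
        ⟪w n (b Ω), b' Ω⟫_ℂ * ⟪c Ω, (c' * a n) Ω⟫_ℂ := by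
      intro n
      rw [W.lact_vec _ _ _ (hwN n) hb hc, W.ract_vec _ _ _ (haN n) hb' hc',
        W.inner_vec _ _ _ _ (mul_mem (hwN n) hb) hc hb' (mul_mem hc' (haN n))]
      rfl
    simp only [heq]
    have hbound : ∀ n, ‖⟪c Ω, (c' * a n) Ω⟫_ℂ‖ ≤ ‖c Ω‖ * ‖c' Ω‖ := by
      intro n
      have h := aux_inner_right M Ω hTr (a n) c' c' (haM n) (hN hc') (hN hc') (haa n)
      rw [inner_self_eq_norm_sq_to_K, inner_self_eq_norm_sq_to_K] at h
      have h2 : ‖(c' * a n) Ω‖ ^ 2 = ‖c' Ω‖ ^ 2 := by exact_mod_cast h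
      have h3 := (sq_eq_sq₀ (norm_nonneg _) (norm_nonneg _)).1 h2
      rw [← h3]
      exact norm_inner_le_norm _ _
    refine squeeze_zero_norm (a := fun n => ‖⟪w n (b Ω), b' Ω⟫_ℂ‖ * (‖c Ω‖ * ‖c' Ω‖)) ?_ ?_
    · intro n
      rw [norm_mul]
      exact mul_le_mul_of_nonneg_left (hbound n) (norm_nonneg _)
    · simpa using (hw0 (b Ω) (b' Ω)).norm.mul_const (‖c Ω‖ * ‖c' Ω‖))
    (T (star v Ω)) (T (u Ω))
  -- the two expressions of `T (u aₙ Ω) = T (wₙ v* Ω)`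
  have hT : ∀ n, W.lact (w n) (T (star v Ω)) = W.ract (a n) (T (u Ω)) := by
    intro n
    obtain ⟨R, hR, hRx⟩ := aux_rightMul M Ω hTr (a n) (haM n) (haa n)
    rw [← hTl (w n) (hwN n), ← hTr' (a n) (haN n) R hR, hRx u huM, huaw n]
    rfl
  have hconst : ∀ n, ⟪W.lact (w n) (T (star v Ω)), W.ract (a n) (T (u Ω))⟫_ℂ =
      ((‖T (u Ω)‖ : ℝ) : ℂ) ^ 2 := by
    intro n
    rw [hT n, inner_self_eq_norm_sq_to_K, hB n]
    rfl
  simp only [hconst] at hmix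
  have h0 := tendsto_nhds_unique hmix tendsto_const_nhds
  have h1 : ((‖T (u Ω)‖ : ℝ) : ℂ) = 0 := by
    first
      | exact pow_eq_zero_iff (two_ne_zero) |>.1 h0.symm
      | exact pow_eq_zero_iff (two_ne_zero) |>.1 h0
  exact norm_eq_zero.1 (by exact_mod_cast h1)

end
end
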